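/- Let n ≥ 2. There exists a volume-preserving holomorphic automorphism of ℂⁿ that is chaotic, i.e., a bijective holomorphic map f : ℂⁿ → ℂⁿ with holomorphic inverse and det Df ≡ 1 which has a dense forward orbit and dense periodic points. -/

import Mathlib

open Topology Filter Metric Set Function

noncomputable section

/-- ℂⁿ with the Euclidean norm. -/
abbrev En (n : ℕ) : Type := EuclideanSpace ℂ (Fin n)

/-- A holomorphic automorphism of ℂⁿ: a bijection that is holomorphic with holomorphic inverse. -/
def IsHoloAut {n : ℕ} (f : En n → En n) : Prop :=
  Differentiable ℂ f ∧ ∃ g : En n → En n, Differentiable ℂ g ∧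
    Function.LeftInverse g f ∧ Function.RightInverse g f

/-- Volume-preserving with respect to ω₀ = dz₁∧⋯∧dzₙ: det Df(z) = 1 for all z. -/
def IsVolPres {n : ℕ} (f : En n → En n) : Prop :=
  ∀ z : En n, (fderiv ℂ f z).det = 1

/-- Aut(ℂⁿ) as a subset of C(ℂⁿ, ℂⁿ) with the compact-open topology. -/
def AutCN (n : ℕ) : Set C(En n, En n) := {f | IsHoloAut ⇑f}

/-- Aut_{ω₀}(ℂⁿ) as a subset of C(ℂⁿ, ℂⁿ) with the compact-open topology. -/
def AutOmega (n : ℕ) : Set C(En n, En n) := {f | IsHoloAut ⇑f ∧ IsVolPres ⇑f}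

/-- A continuous self-map is chaotic if it has a dense forward orbit and its set of
periodic points is dense. -/
def Chaotic {α : Type*} [TopologicalSpace α] (f : α → α) : Prop :=
  (∃ x : α, Dense (Set.range fun k : ℕ => f^[k] x)) ∧
  Dense {x : α | ∃ k : ℕ, 0 < k ∧ f^[k] x = x}

/-- Expelling: the set of points with unbounded forward orbit is dense. -/
def Expelling {n : ℕ} (f : En n → En n) : Prop :=
  Dense {x : En n | ¬ Bornology.IsBounded (Set.range fun k : ℕ => f^[k] x)}

/-- p is a hyperbolic fixed point of f: f(p) = p and no eigenvalue of Df(p) has modulus 1. -/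
def HypFixedPt {n : ℕ} (f : En n → En n) (p : En n) : Prop :=
  f p = p ∧ ∀ μ : ℂ, Module.End.HasEigenvalue
    ((fderiv ℂ f p : En n →ₗ[ℂ] En n) : Module.End ℂ (En n)) μ → ‖μ‖ ≠ 1

/-- The stable manifold of a fixed point p of f: points whose forward orbit tends to p. -/
def StableSet {n : ℕ} (f : En n → En n) (p : En n) : Set (En n) :=
  {x : En n | Tendsto (fun k : ℕ => f^[k] x) atTop (𝓝 p)}

set_option maxHeartbeats 400000
set_option linter.all false

namespace ChaosAux
open Polynomial

variable {n : ℕ}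

/-- shear map -/
def shFun (ℓ : En n →L[ℂ] ℂ) (b : En n) (q : ℂ[X]) (y : En n) : En n := y + (q.eval (ℓ y)) • b

lemma shFun_cont (ℓ : En n →L[ℂ] ℂ) (b : En n) (q : ℂ[X]) : Continuous (shFun ℓ b q) := by
  unfold shFun
  exact continuous_id.add ((q.continuous.comp ℓ.continuous).smul continuous_const)

lemma ell_shFun {ℓ : En n →L[ℂ] ℂ} {b : En n} (h : ℓ b = 0) (q : ℂ[X]) (y : En n) :
    ℓ (shFun ℓ b q y) = ℓ y := by simp [shFun, h]

/-- shear homeomorphism -/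
def sh (ℓ : En n →L[ℂ] ℂ) (b : En n) (h : ℓ b = 0) (q : ℂ[X]) : En n ≃ₜ En n where
  toFun := shFun ℓ b q
  invFun := shFun ℓ b (-q)
  left_inv y := by
    have := ell_shFun h q y
    rw [shFun, this]; simp [shFun]
  right_inv y := by
    have := ell_shFun h (-q) y
    rw [shFun, this]; simp [shFun]
  continuous_toFun := shFun_cont _ _ _
  continuous_invFun := shFun_cont _ _ _

lemma sh_apply (ℓ : En n →L[ℂ] ℂ) (b : En n) (h : ℓ b = 0) (q : ℂ[X]) (y : En n) :
    sh ℓ b h q y = y + (q.eval (ℓ y)) • b := rfl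

lemma sh_symm_apply (ℓ : En n →L[ℂ] ℂ) (b : En n) (h : ℓ b = 0) (q : ℂ[X]) (y : En n) :
    (sh ℓ b h q).symm y = y - (q.eval (ℓ y)) • b := by
  change y + ((-q).eval (ℓ y)) • b = _
  simp [sub_eq_add_neg]

lemma sh_inv (ℓ : En n →L[ℂ] ℂ) (b : En n) (h : ℓ b = 0) (q : ℂ[X]) :
    (sh ℓ b h q)⁻¹ = sh ℓ b h (-q) := by
  ext1 y
  change (sh ℓ b h q).symm y = _
  rw [sh_symm_apply, sh_apply]; simp [sub_eq_add_neg]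

/-- the group -/
def Gam (n : ℕ) : Subgroup (En n ≃ₜ En n) :=
  Subgroup.closure {e | ∃ ℓ b h q, e = sh ℓ b h q}

lemma sh_mem (ℓ : En n →L[ℂ] ℂ) (b : En n) (h : ℓ b = 0) (q : ℂ[X]) : sh ℓ b h q ∈ Gam n :=
  Subgroup.subset_closure ⟨_, _, _, _, rfl⟩

/-- polynomial functions -/
def PF (n : ℕ) : Subalgebra ℂ (En n → ℂ) :=
  Algebra.adjoin ℂ (Set.range fun (i : Fin n) => (fun y : En n => y i))

lemma coord_mem (i : Fin n) : (fun y : En n => y i) ∈ PF n := Algebra.subset_adjoin ⟨i, rfl⟩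

lemma ell_mem (ℓ : En n →L[ℂ] ℂ) : (fun y => ℓ y) ∈ PF n := by
  have : (fun y => ℓ y) = ∑ i : Fin n, (ℓ (EuclideanSpace.single i 1)) • (fun y : En n => y i) := by
    ext y
    conv_lhs => rw [← (EuclideanSpace.basisFun (Fin n) ℂ).sum_repr y]
    simp [mul_comm]
  rw [this]
  exact Subalgebra.sum_mem _ fun i _ => Subalgebra.smul_mem _ (coord_mem i) _

lemma polycomp_mem {p : En n → ℂ} (hp : p ∈ PF n) (q : ℂ[X]) : (fun y => q.eval (p y)) ∈ PF n := by
  have : (fun y => q.eval (p y)) = Polynomial.aeval p q := by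
    ext y
    induction q using Polynomial.induction_on' with
    | add a b ha hb => rw [Polynomial.eval_add, map_add, Pi.add_apply, ha, hb]
    | monomial k c => simp [Polynomial.aeval_monomial]
  rw [this]
  exact Polynomial.aeval_mem_adjoin_singleton ℂ p |> fun h =>
    (Algebra.adjoin_le (S := PF n) (by simpa using hp)) h

/-- polynomial maps -/
def PM (f : En n → En n) : Prop := ∀ i, (fun y => f y i) ∈ PF n

lemma PF.comp {p : En n → ℂ} (hp : p ∈ PF n) {f : En n → En n} (hf : PM f) :
    (fun y => p (f y)) ∈ PF n := by
  induction hp using Algebra.adjoin_induction with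
  | mem x hx => obtain ⟨i, rfl⟩ := hx; exact hf i
  | algebraMap r => exact Subalgebra.algebraMap_mem (PF n) r
  | add x y _ _ hx hy => exact add_mem hx hy
  | mul x y _ _ hx hy => exact mul_mem hx hy

lemma PM.comp {f g : En n → En n} (hf : PM f) (hg : PM g) : PM (f ∘ g) :=
  fun i => PF.comp (hf i) hg

lemma PM.id : PM (_root_.id : En n → En n) := fun i => coord_mem i

lemma PM.iterate {f : En n → En n} (hf : PM f) : ∀ k, PM (f^[k])
  | 0 => PM.id
  | k+1 => (PM.iterate hf k).comp hf

lemma shFun_PM (ℓ : En n →L[ℂ] ℂ) (b : En n) (q : ℂ[X]) : PM (shFun ℓ b q) := by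
  intro i
  have : (fun y => shFun ℓ b q y i) = (fun y : En n => y i) + b i • (fun y => q.eval (ℓ y)) := by
    ext y; simp [shFun, mul_comm]
  rw [this]
  exact add_mem (coord_mem i) (Subalgebra.smul_mem _ (polycomp_mem (ell_mem ℓ) q) _)

lemma PF.diff {p : En n → ℂ} (hp : p ∈ PF n) : Differentiable ℂ p := by
  induction hp using Algebra.adjoin_induction with
  | mem x hx => 
    obtain ⟨i, rfl⟩ := hx
    exact (EuclideanSpace.proj i : En n →L[ℂ] ℂ).differentiable
  | algebraMap r => exact differentiable_const _
  | add x y _ _ hx hy => exact hx.add hy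
  | mul x y _ _ hx hy => exact hx.mul hy

lemma PM.diff {f : En n → En n} (hf : PM f) : Differentiable ℂ f := by
  rw [differentiable_euclidean]
  exact fun i => PF.diff (hf i)

lemma shFun_hasFDerivAt (ℓ : En n →L[ℂ] ℂ) (b : En n) (q : ℂ[X]) (y : En n) :
    HasFDerivAt (shFun ℓ b q) (ContinuousLinearMap.id ℂ (En n) +
      (q.derivative.eval (ℓ y) • ℓ).smulRight b) y := by
  unfold shFun
  refine (hasFDerivAt_id y).add ?_
  have := ((q.hasDerivAt (ℓ y)).comp_hasFDerivAt y ℓ.hasFDerivAt).smul_const b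
  exact this

lemma det_one_add_smulRight (ℓ : En n →L[ℂ] ℂ) (b : En n) (c : ℂ) :
    (ContinuousLinearMap.id ℂ (En n) + (c • ℓ).smulRight b).det = 1 + c * ℓ b := by
  have : ((ContinuousLinearMap.id ℂ (En n) + (c • ℓ).smulRight b : En n →L[ℂ] En n) : En n →ₗ[ℂ] En n)
    = LinearMap.transvection ((c • ℓ : En n →L[ℂ] ℂ) : Module.Dual ℂ (En n)) b := by
    ext y; simp [LinearMap.transvection]
  rw [ContinuousLinearMap.det, this, LinearMap.transvection.det]
  simp

/-- good homeos: polynomial with derivative det 1 -/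
def Good (e : En n ≃ₜ En n) : Prop := PM e ∧ PM e.symm ∧ ∀ z, (fderiv ℂ e z).det = 1

lemma det_comp (A B : En n →L[ℂ] En n) : (A.comp B).det = A.det * B.det := by
  simp [ContinuousLinearMap.det]

lemma Good.mul {e e' : En n ≃ₜ En n} (h : Good e) (h' : Good e') : Good (e * e') := by
  refine ⟨h.1.comp h'.1, h'.2.1.comp h.2.1, fun z => ?_⟩
  have : fderiv ℂ (e ∘ e') z = _ := fderiv_comp z (h.1.diff _) (h'.1.diff _)
  change (fderiv ℂ (e ∘ e') z).det = 1
  rw [this, det_comp, h.2.2, h'.2.2, one_mul]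

lemma Good.inv {e : En n ≃ₜ En n} (h : Good e) : Good e⁻¹ := by
  refine ⟨h.2.1, h.1, fun z => ?_⟩
  change (fderiv ℂ e.symm z).det = 1
  have h1 : fderiv ℂ (e ∘ e.symm) z = _ := fderiv_comp z (h.1.diff _) (h.2.1.diff _)
  have h2 : (e ∘ e.symm) = _root_.id := by ext1 y; simp
  rw [h2, fderiv_id] at h1
  have := congrArg ContinuousLinearMap.det h1
  rw [det_comp, h.2.2] at this
  simpa [ContinuousLinearMap.det] using this.symm

lemma sh_good (ℓ : En n →L[ℂ] ℂ) (b : En n) (h : ℓ b = 0) (q : ℂ[X]) : Good (sh ℓ b h q) := by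
  refine ⟨shFun_PM _ _ _, shFun_PM _ _ _, fun z => ?_⟩
  change (fderiv ℂ (shFun ℓ b q) z).det = 1
  rw [(shFun_hasFDerivAt ℓ b q z).fderiv, det_one_add_smulRight, h]
  simp

lemma Gam.good {e : En n ≃ₜ En n} (h : e ∈ Gam n) : Good e := by
  induction h using Subgroup.closure_induction with
  | mem x hx => obtain ⟨ℓ, b, h, q, rfl⟩ := hx; exact sh_good _ _ _ _
  | one => 
    refine ⟨PM.id, PM.id, fun z => ?_⟩
    change (fderiv ℂ (_root_.id) z).det = 1
    rw [fderiv_id]; simp [ContinuousLinearMap.det]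
  | mul x y _ _ hx hy => exact hx.mul hy
  | inv x _ hx => exact hx.inv

end ChaosAux

namespace ChaosAux
open Polynomial

variable {n : ℕ}

/-- function space -/
abbrev FS (n : ℕ) : Type := C(En n, En n) × C(En n, En n)

/-- embedding -/
def iota (e : En n ≃ₜ En n) : FS n := (⟨e, e.continuous⟩, ⟨e.symm, e.symm.continuous⟩)

lemma nhds_sub {f : C(En n, En n)} {V : Set C(En n, En n)} (hV : V ∈ 𝓝 f) :
    ∃ R, ∃ ε > 0, ∀ g : C(En n, En n), (∀ z ∈ closedBall (0 : En n) R, ‖g z - f z‖ < ε) → g ∈ V := by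
  rw [nhds_eq_comap_uniformity, mem_comap] at hV
  obtain ⟨W, hW, hWV⟩ := hV
  obtain ⟨⟨K, S⟩, ⟨hK, hS⟩, hsub⟩ := (ContinuousMap.hasBasis_compactConvergenceUniformity
    (α := En n) (β := En n)).mem_iff.1 hW
  obtain ⟨ε, hε, hεS⟩ := Metric.mem_uniformity_dist.1 hS
  obtain ⟨R, hR⟩ := hK.isBounded.subset_closedBall 0
  refine ⟨R, ε, hε, fun g hg => hWV (hsub fun x hx => hεS ?_)⟩
  rw [dist_comm, dist_eq_norm]
  exact hg x (hR hx)

lemma nhds_ball (f : C(En n, En n)) (R : ℝ) {ε : ℝ} (hε : 0 < ε) :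
    {g : C(En n, En n) | ∀ z ∈ closedBall (0 : En n) R, ‖g z - f z‖ < ε} ∈ 𝓝 f := by
  rw [nhds_eq_comap_uniformity, mem_comap]
  refine ⟨_, (ContinuousMap.hasBasis_compactConvergenceUniformity
    (α := En n) (β := En n)).mem_of_mem (i := ⟨closedBall 0 R, {p | dist p.1 p.2 < ε}⟩)
      ⟨isCompact_closedBall _ _, Metric.dist_mem_uniformity hε⟩, ?_⟩
  intro g hg z hz
  have := hg z hz
  rw [← dist_eq_norm, dist_comm]
  exact this

lemma near_comp {N : Set (FS n)} (hN : IsOpen N) {e : En n ≃ₜ En n} (he : iota e ∈ N) (R0 : ℝ) :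
    ∃ R ≥ R0, ∃ ε > 0, ∀ ψ : En n ≃ₜ En n, (∀ z ∈ closedBall (0 : En n) R, ‖ψ z - z‖ < ε ∧
      ‖ψ.symm z - z‖ < ε) → iota (ψ * e) ∈ N := by
  let F : FS n → FS n := fun p => (p.1.comp (iota e).1, (iota e).2.comp p.2)
  have hF : Continuous F := by
    refine Continuous.prodMk ?_ ?_
    · exact (ContinuousMap.continuous_precomp _).comp continuous_fst
    · exact (ContinuousMap.continuous_postcomp _).comp continuous_snd
  have h1 : F ⁻¹' N ∈ 𝓝 (ContinuousMap.id _, ContinuousMap.id _) := by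
    apply (hN.preimage hF).mem_nhds
    change F _ ∈ N
    have : F (ContinuousMap.id _, ContinuousMap.id _) = iota e := by ext1 <;> rfl
    rwa [this]
  rw [nhds_prod_eq, mem_prod_iff] at h1
  obtain ⟨V1, hV1, V2, hV2, hsub⟩ := h1
  obtain ⟨R1, ε1, hε1, H1⟩ := nhds_sub hV1
  obtain ⟨R2, ε2, hε2, H2⟩ := nhds_sub hV2
  refine ⟨max R0 (max R1 R2), le_max_left _ _, min ε1 ε2, lt_min hε1 hε2, fun ψ hψ => ?_⟩
  have : iota (ψ * e) = F (iota ψ) := by ext1 <;> rfl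
  rw [this]
  refine hsub (Set.mk_mem_prod (H1 _ fun z hz => ?_) (H2 _ fun z hz => ?_))
  · exact (hψ z (closedBall_subset_closedBall ((le_max_left _ _).trans (le_max_right _ _)) hz)).1.trans_le (min_le_left _ _)
  · exact (hψ z (closedBall_subset_closedBall ((le_max_right _ _).trans (le_max_right _ _)) hz)).2.trans_le (min_le_right _ _)

lemma small_shear {N : Set (FS n)} (hN : IsOpen N) {e : En n ≃ₜ En n} (he : iota e ∈ N)
    (ℓ : En n →L[ℂ] ℂ) (b : En n) (h : ℓ b = 0) (q : ℂ[X]) :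
    ∃ t0 > 0, ∀ t : ℂ, ‖t‖ ≤ t0 → iota (sh ℓ b h (C t * q) * e) ∈ N := by
  obtain ⟨R, -, ε, hε, H⟩ := near_comp hN he 0
  obtain ⟨M, hM⟩ := (isCompact_closedBall (0 : En n) R).exists_bound_of_continuousOn
    (f := fun z => (q.eval (ℓ z)) • b) ((q.continuous.comp ℓ.continuous).smul continuous_const).continuousOn
  have hM' : 0 < |M| + 1 := by positivity
  refine ⟨ε / 2 / (|M| + 1), by positivity, fun t ht => H _ fun z hz => ?_⟩
  have : ‖((C t * q).eval (ℓ z)) • b‖ < ε := by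
    have h1 : ((C t * q).eval (ℓ z)) • b = t • ((q.eval (ℓ z)) • b) := by simp [mul_smul]
    rw [h1, norm_smul]
    calc ‖t‖ * ‖(q.eval (ℓ z)) • b‖ ≤ (ε / 2 / (|M| + 1)) * (|M| + 1) := by
          gcongr
          exact (hM z hz).trans ((le_abs_self M).trans (by linarith))
      _ < ε := by field_simp; linarith
  rw [sh_apply, sh_symm_apply]
  constructor
  · simpa using this
  · rw [show z - ((C t * q).eval (ℓ z)) • b - z = - (((C t * q).eval (ℓ z)) • b) by abel, norm_neg]
    exact this

lemma cont_iter (k : ℕ) : Continuous fun p : C(En n, En n) × En n => p.1^[k] p.2 := by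
  induction k with
  | zero => exact continuous_snd
  | succ k ih =>
    simp_rw [Function.iterate_succ_apply']
    have : Continuous fun p : C(En n, En n) × En n => (p.1, p.1^[k] p.2) := continuous_fst.prodMk ih
    exact ContinuousEval.continuous_eval.comp this

lemma cauchy_fderiv {h : En n → En n} (hd : Differentiable ℂ h) {x : En n} {ρ M : ℝ} (hρ : 0 < ρ)
    (hM : ∀ y ∈ closedBall x ρ, ‖h y‖ ≤ M) : ‖fderiv ℂ h x‖ ≤ M / ρ := by
  have hM0 : 0 ≤ M := (norm_nonneg _).trans (hM x (mem_closedBall_self hρ.le))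
  refine ContinuousLinearMap.opNorm_le_bound _ (by positivity) fun v => ?_
  by_cases hv : v = 0
  · simp [hv]
  have hv' : 0 < ‖v‖ := norm_pos_iff.2 hv
  have hlin : ∀ t : ℂ, HasDerivAt (fun t : ℂ => x + t • v) v t := fun t => by
    simpa using ((hasDerivAt_id t).smul_const v).const_add x
  have hder : ∀ t : ℂ, HasDerivAt (fun t : ℂ => h (x + t • v)) (fderiv ℂ h (x + t • v) v) t := fun t =>
    (hd (x + t • v)).hasFDerivAt.comp_hasDerivAt t (hlin t)
  have hdd : Differentiable ℂ (fun t : ℂ => h (x + t • v)) := fun t => (hder t).differentiableAt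
  have := Complex.norm_deriv_le_of_forall_mem_sphere_norm_le (c := 0) (R := ρ / ‖v‖) (C := M)
    (f := fun t : ℂ => h (x + t • v)) (by positivity) hdd.diffContOnCl (by
      intro z hz
      apply hM
      have : ‖z‖ = ρ / ‖v‖ := by simpa using hz
      rw [mem_closedBall, dist_eq_norm, add_sub_cancel_left, norm_smul, this]
      field_simp; rfl)
  rw [(hder 0).deriv] at this
  simp only [zero_smul, add_zero] at this
  calc _ ≤ _ := this
    _ = M / ρ * ‖v‖ := by field_simp

lemma limit_holo {F : ℕ → C(En n, En n)} {f : C(En n, En n)} (hF : Tendsto F atTop (𝓝 f))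
    (hd : ∀ k, Differentiable ℂ (F k)) :
    Differentiable ℂ f ∧ ∀ x, Tendsto (fun k => fderiv ℂ (F k) x) atTop (𝓝 (fderiv ℂ f x)) := by
  have hU := ContinuousMap.tendsto_iff_forall_isCompact_tendstoUniformlyOn.1 hF
  have key : ∀ x : En n, ∀ ε > 0, ∃ N, ∀ k ≥ N, ∀ l ≥ N, ∀ y ∈ ball x 1,
      ‖fderiv ℂ (F k) y - fderiv ℂ (F l) y‖ < ε := by
    intro x ε hε
    have h1 := (Metric.uniformCauchySeqOn_iff.1 (hU _ (isCompact_closedBall x 2)).uniformCauchySeqOn)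
      (ε/2) (by positivity)
    obtain ⟨N, hN⟩ := h1
    refine ⟨N, fun k hk l hl y hy => ?_⟩
    rw [← fderiv_sub (hd k y) (hd l y)]
    have := cauchy_fderiv ((hd k).sub (hd l)) (x := y) (ρ := 1) (M := ε/2) one_pos (by
      intro z hz
      have hz' : z ∈ closedBall x 2 := by
        rw [mem_closedBall] at *
        rw [mem_ball] at hy
        linarith [dist_triangle z y x]
      have := hN k hk l hl z hz'
      rw [dist_eq_norm] at this
      exact this.le)
    linarith
  have hc : ∀ x, CauchySeq fun k => fderiv ℂ (F k) x := by
    intro x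
    rw [Metric.cauchySeq_iff]
    intro ε hε
    obtain ⟨N, hN⟩ := key x ε hε
    exact ⟨N, fun k hk l hl => by
      rw [dist_eq_norm]; exact hN k hk l hl x (mem_ball_self one_pos)⟩
  choose g' hg' using fun x => cauchySeq_tendsto_of_complete (hc x)
  have hder : ∀ x, HasFDerivAt f (g' x) x := by
    intro x
    refine hasFDerivAt_of_tendstoUniformlyOn (l := atTop) (f := fun k => ⇑(F k)) (f' := fun k y => fderiv ℂ (F k) y)
      (s := ball x 1) isOpen_ball ?_ (fun k y _ => (hd k y).hasFDerivAt) ?_ (mem_ball_self one_pos)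
    · refine UniformCauchySeqOn.tendstoUniformlyOn_of_tendsto ?_ fun y _ => hg' y
      rw [Metric.uniformCauchySeqOn_iff]
      intro ε hε
      obtain ⟨N, hN⟩ := key x ε hε
      exact ⟨N, fun k hk l hl y hy => by rw [dist_eq_norm]; exact hN k hk l hl y hy⟩
    · intro y _
      exact (hU {y} isCompact_singleton).tendsto_at (mem_singleton y)
  refine ⟨fun x => (hder x).differentiableAt, fun x => ?_⟩
  rw [(hder x).fderiv]
  exact hg' x

lemma continuous_det : Continuous fun A : En n →L[ℂ] En n => A.det := 
  ContinuousLinearMap.continuous_det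

/-- the complete space -/
def XS (n : ℕ) : Set (FS n) := closure (iota '' (Gam n : Set (En n ≃ₜ En n)))

lemma XS_prop {p : FS n} (hp : p ∈ XS n) : Differentiable ℂ p.1 ∧ Differentiable ℂ p.2 ∧
    LeftInverse p.2 p.1 ∧ RightInverse p.2 p.1 ∧ ∀ z, (fderiv ℂ p.1 z).det = 1 := by
  obtain ⟨s, hs, hlim⟩ := mem_closure_iff_seq_limit.1 hp
  choose e he hes using hs
  have h1 : Tendsto (fun k => (s k).1) atTop (𝓝 p.1) := (continuous_fst.tendsto p).comp hlim
  have h2 : Tendsto (fun k => (s k).2) atTop (𝓝 p.2) := (continuous_snd.tendsto p).comp hlim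
  have l1 := limit_holo h1 fun k => by rw [← hes]; exact (Gam.good (he k)).1.diff
  have l2 := limit_holo h2 fun k => by rw [← hes]; exact (Gam.good (he k)).2.1.diff
  have hcl : IsClosed {p : FS n | ∀ x, p.2 (p.1 x) = x ∧ p.1 (p.2 x) = x} := by
    simp_rw [setOf_forall, setOf_and]
    have c1 : Continuous fun p : FS n => p.1 := continuous_fst
    have c2 : Continuous fun p : FS n => p.2 := continuous_snd
    refine isClosed_iInter fun x => IsClosed.inter (isClosed_eq ?_ continuous_const) (isClosed_eq ?_ continuous_const)
    · exact c2.eval (c1.eval continuous_const)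
    · exact c1.eval (c2.eval continuous_const)
  have hinv : ∀ x, p.2 (p.1 x) = x ∧ p.1 (p.2 x) = x := by
    have : XS n ⊆ {p : FS n | ∀ x, p.2 (p.1 x) = x ∧ p.1 (p.2 x) = x} := by
      apply closure_minimal _ hcl
      rintro _ ⟨e, -, rfl⟩ x
      exact ⟨e.symm_apply_apply x, e.apply_symm_apply x⟩
    exact this hp
  refine ⟨l1.1, l2.1, fun x => (hinv x).1, fun x => (hinv x).2, fun z => ?_⟩
  refine tendsto_nhds_unique (((continuous_det (n := n)).tendsto _).comp (l1.2 z)) ?_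
  refine tendsto_const_nhds.congr fun k => ?_
  change 1 = (fderiv ℂ (s k).1 z).det
  rw [← hes]
  exact ((Gam.good (he k)).2.2 z).symm

instance : BaireSpace (XS n) := by
  have : IsClosed (XS n) := isClosed_closure
  have := this.isCompletelyPseudoMetrizableSpace
  infer_instance

end ChaosAux

namespace ChaosAux
open Polynomial

variable {n : ℕ}

lemma near_comp' {N : Set (FS n)} (hN : IsOpen N) {e : En n ≃ₜ En n} (he : iota e ∈ N) :
    ∃ N' : Set (FS n), IsOpen N' ∧ iota e ∈ N' ∧ ∃ R, ∃ ε > 0, ∀ e' ψ : En n ≃ₜ En n,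
     iota e' ∈ N' → (∀ z ∈ closedBall (0 : En n) R, ‖ψ z - z‖ < ε ∧
      ‖ψ.symm z - z‖ < ε) → iota (ψ * e') ∈ N := by
  let F : FS n × FS n → FS n := fun p => (p.1.1.comp p.2.1, p.2.2.comp p.1.2)
  have hF : Continuous F := by
    refine Continuous.prodMk ?_ ?_
    · exact ContinuousMap.continuous_comp'.comp 
        ((continuous_fst.comp continuous_snd).prodMk (continuous_fst.comp continuous_fst))
    · exact ContinuousMap.continuous_comp'.comp 
        ((continuous_snd.comp continuous_fst).prodMk (continuous_snd.comp continuous_snd))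
  have h1 : F ⁻¹' N ∈ 𝓝 (((ContinuousMap.id _, ContinuousMap.id _) : FS n), iota e) := by
    apply (hN.preimage hF).mem_nhds
    change F _ ∈ N
    have : F ((ContinuousMap.id _, ContinuousMap.id _), iota e) = iota e := by ext1 <;> rfl
    rwa [this]
  rw [nhds_prod_eq, mem_prod_iff] at h1
  obtain ⟨V, hV, W, hW, hsub⟩ := h1
  rw [nhds_prod_eq, mem_prod_iff] at hV
  obtain ⟨V1, hV1, V2, hV2, hsub2⟩ := hV
  obtain ⟨R1, ε1, hε1, H1⟩ := nhds_sub hV1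
  obtain ⟨R2, ε2, hε2, H2⟩ := nhds_sub hV2
  obtain ⟨N', hN'W, hN', heN'⟩ := mem_nhds_iff.1 hW
  refine ⟨N', hN', heN', (max R1 R2), min ε1 ε2, lt_min hε1 hε2, fun e' ψ he' hψ => ?_⟩
  have : iota (ψ * e') = F (iota ψ, iota e') := by ext1 <;> rfl
  rw [this]
  refine hsub (Set.mk_mem_prod (hsub2 (Set.mk_mem_prod (H1 _ fun z hz => ?_) (H2 _ fun z hz => ?_))) (hN'W he'))
  · exact (hψ z (closedBall_subset_closedBall (le_max_left _ _) hz)).1.trans_le (min_le_left _ _)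
  · exact (hψ z (closedBall_subset_closedBall (le_max_right _ _) hz)).2.trans_le (min_le_right _ _)

/-- moving points -/
def Mv (R : ℝ) (x y : En n) : Prop := ∀ S : Finset (En n), (∀ s ∈ S, ‖s‖ ≤ R) → ∀ ε > 0,
  ∃ ψ ∈ Gam n, (∀ s ∈ S, ψ s = s) ∧ (∀ z ∈ closedBall (0 : En n) R, ‖ψ z - z‖ < ε ∧
      ‖ψ.symm z - z‖ < ε) ∧ ψ x = y

lemma Mv.trans {R R' : ℝ} (hR : R < R') {x y z : En n} (h1 : Mv R' x y) (h2 : Mv R' y z) :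
    Mv R x z := by
  intro S hS ε hε
  have hδ : 0 < min (ε / 2) (R' - R) := lt_min (by positivity) (by linarith)
  obtain ⟨ψ1, m1, f1, c1, e1⟩ := h1 S (fun s hs => (hS s hs).trans hR.le) _ hδ
  obtain ⟨ψ2, m2, f2, c2, e2⟩ := h2 S (fun s hs => (hS s hs).trans hR.le) _ hδ
  have aux : ∀ a b : En n → En n, (∀ z ∈ closedBall (0 : En n) R', ‖a z - z‖ < min (ε / 2) (R' - R)) →
      (∀ z ∈ closedBall (0 : En n) R', ‖b z - z‖ < min (ε / 2) (R' - R)) → 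
      ∀ w ∈ closedBall (0 : En n) R, ‖b (a w) - w‖ < ε := by
    intro a b ha hb w hw
    have hw' : ‖w‖ ≤ R := by simpa using hw
    have k1 := ha w (closedBall_subset_closedBall hR.le hw)
    have : a w ∈ closedBall (0 : En n) R' := by
      have := norm_le_norm_add_norm_sub' (a w) w
      rw [mem_closedBall, dist_zero_right]
      linarith [min_le_right (ε / 2) (R' - R)]
    have k2 := hb _ this
    calc ‖b (a w) - w‖ = ‖(b (a w) - a w) + (a w - w)‖ := by congr 1; abel
      _ ≤ _ := norm_add_le _ _
      _ < ε := by linarith [min_le_left (ε / 2) (R' - R)]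
  refine ⟨ψ2 * ψ1, mul_mem m2 m1, fun s hs => ?_, fun w hw => ⟨?_, ?_⟩, ?_⟩
  · change ψ2 (ψ1 s) = s
    rw [f1 s hs, f2 s hs]
  · exact aux ψ1 ψ2 (fun z hz => (c1 z hz).1) (fun z hz => (c2 z hz).1) w hw
  · exact aux ψ2.symm ψ1.symm (fun z hz => (c2 z hz).2) (fun z hz => (c1 z hz).2) w hw
  · change ψ2 (ψ1 x) = z
    rw [e1, e2]

lemma mv_shear {R : ℝ} {x w b : En n} (hR0 : 0 ≤ R) (hx : R < ‖x‖) (hw : inner ℂ x w = inner ℂ x x)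
    (hb : inner ℂ x b = 0) : Mv R w (w + b) := by
  intro S hS ε hε
  set ℓ : En n →L[ℂ] ℂ := innerSL ℂ x with hℓ
  have hℓa : ∀ y, ℓ y = inner ℂ x y := fun y => rfl
  have hxp : 0 < ‖x‖ := hR0.trans_lt hx
  set s0 : ℂ := inner ℂ x x with hs0
  have hs0n : ‖s0‖ = ‖x‖ * ‖x‖ := by
    rw [hs0, inner_self_eq_norm_sq_to_K]; simp [sq]
  have hℓb : ∀ y, ‖y‖ ≤ R → ‖ℓ y‖ ≤ ‖x‖ * R := fun y hy =>
    (norm_inner_le_norm x y).trans (by gcongr)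
  set Q : ℂ[X] := ∏ s ∈ S, (X - C (ℓ s)) with hQ
  have hQ0 : Q.eval s0 ≠ 0 := by
    rw [hQ, eval_prod, Finset.prod_ne_zero_iff]
    intro s hs h0
    simp only [eval_sub, eval_X, eval_C] at h0
    have h1 := hℓb s (hS s hs)
    rw [← sub_eq_zero.1 h0, hs0n] at h1
    nlinarith
  have hs00 : s0 ≠ 0 := by
    rw [← norm_pos_iff, hs0n]; positivity
  obtain ⟨K, hK⟩ := (isCompact_closedBall (0 : En n) R).exists_bound_of_continuousOn
    (f := fun z => (Q.eval (ℓ z) / Q.eval s0) • b)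
      (((Q.continuous.comp ℓ.continuous).div_const _).smul continuous_const).continuousOn
  have hK0 : 0 ≤ K := (norm_nonneg _).trans (hK 0 (by simpa using hR0))
  have hlt : R / ‖x‖ < 1 := (div_lt_one hxp).2 hx
  have hlim : Tendsto (fun m : ℕ => (R / ‖x‖) ^ m * K) atTop (𝓝 (0 * K)) :=
    (tendsto_pow_atTop_nhds_zero_of_lt_one (by positivity) hlt).mul_const K
  rw [zero_mul] at hlim
  obtain ⟨m, hm⟩ := (hlim.eventually (gt_mem_nhds hε)).exists
  set q : ℂ[X] := C (1 / (s0 ^ m * Q.eval s0)) * (X ^ m * Q) with hq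
  have hb' : ℓ b = 0 := hb
  have hqe : ∀ s, q.eval s = (s / s0) ^ m * (Q.eval s / Q.eval s0) := by
    intro s; rw [div_pow]; simp [hq]; field_simp
  have small : ∀ z ∈ closedBall (0 : En n) R, ‖q.eval (ℓ z) • b‖ < ε := by
    intro z hz
    rw [hqe, mul_smul, norm_smul]
    refine lt_of_le_of_lt ?_ hm
    gcongr
    · rw [norm_pow, norm_div]
      refine pow_le_pow_left₀ (by positivity) ?_ m
      rw [hs0n, div_le_div_iff₀ (by positivity) hxp]
      have := hℓb z (by simpa using hz)
      nlinarith
    · exact hK z hz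
  refine ⟨sh ℓ b hb' q, sh_mem _ _ _ _, fun s hs => ?_, fun z hz => ?_, ?_⟩
  · rw [sh_apply, hqe]
    have : Q.eval (ℓ s) = 0 := by
      rw [hQ, eval_prod]
      exact Finset.prod_eq_zero hs (by simp)
    simp [this]
  · rw [sh_apply, sh_symm_apply]
    constructor
    · simpa using small z hz
    · rw [show z - (q.eval (ℓ z)) • b - z = - ((q.eval (ℓ z)) • b) by abel, norm_neg]
      exact small z hz
  · rw [sh_apply, hqe, hℓa, hw, div_self hs00, div_self hQ0]; simp

lemma mv_two {R : ℝ} {x y : En n} (hR0 : 0 ≤ R) (hx : R < ‖x‖) (hy : R < ‖y‖)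
    (hG : inner ℂ x x * inner ℂ y y - inner ℂ x y * inner ℂ y x ≠ 0) : Mv R x y := by
  obtain ⟨R', h1, h2⟩ := exists_between (lt_min hx hy)
  have hx' := h2.trans_le (min_le_left _ _)
  have hy' := h2.trans_le (min_le_right _ _)
  set G := inner ℂ x x * inner ℂ y y - inner ℂ x y * inner ℂ y x with hGd
  set z : En n := ((inner ℂ x x * inner ℂ y y - inner ℂ x y * inner ℂ y y) / G) • x +
     ((inner ℂ x x * inner ℂ y y - inner ℂ y x * inner ℂ x x) / G) • y with hz
  have e1 : inner ℂ x z = inner ℂ x x := by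
    rw [hz, inner_add_right, inner_smul_right, inner_smul_right]
    field_simp
    rw [hGd]; ring
  have e2 : inner ℂ y z = inner ℂ y y := by
    rw [hz, inner_add_right, inner_smul_right, inner_smul_right]
    field_simp
    rw [hGd]; ring
  have m1 : Mv R' x (x + (z - x)) := mv_shear (hR0.trans h1.le) hx' rfl (by rw [inner_sub_right, e1, sub_self])
  have m2 : Mv R' z (z + (y - z)) := mv_shear (hR0.trans h1.le) hy' e2 (by rw [inner_sub_right, e2, sub_self])
  rw [add_sub_cancel] at m1 m2
  exact m1.trans h1 m2

lemma exists_ker (hn : 2 ≤ n) (ℓ : En n →L[ℂ] ℂ) : ∃ b, b ≠ 0 ∧ ℓ b = 0 := by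
  have := LinearMap.ker_ne_bot_of_finrank_lt (f := (ℓ : En n →ₗ[ℂ] ℂ)) (by simp; omega)
  obtain ⟨b, hb, hb0⟩ := Submodule.exists_mem_ne_zero_of_ne_bot this
  exact ⟨b, hb0, hb⟩

lemma mv_all (hn : 2 ≤ n) {R : ℝ} {x y : En n} (hR0 : 0 ≤ R) (hx : R < ‖x‖) (hy : R < ‖y‖) : Mv R x y := by
  obtain ⟨R', h1, h2⟩ := exists_between (lt_min hx hy)
  have hx' := h2.trans_le (min_le_left _ _)
  have hy' := h2.trans_le (min_le_right _ _)
  have hR0' := hR0.trans h1.le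
  by_cases hG : inner ℂ x x * inner ℂ y y - inner ℂ x y * inner ℂ y x = 0
  swap
  · exact mv_two hR0 hx hy hG
  have hx0 : x ≠ 0 := by rw [← norm_pos_iff]; linarith
  have hy0 : y ≠ 0 := by rw [← norm_pos_iff]; linarith
  obtain ⟨v, hv0, hv⟩ := exists_ker hn (innerSL ℂ x)
  have hv : inner ℂ x v = 0 := hv
  have hv' : inner ℂ v x = 0 := by rw [← inner_conj_symm, hv, map_zero]
  have ixx : inner ℂ x x ≠ 0 := inner_self_ne_zero.2 hx0
  have ivv : inner ℂ v v ≠ 0 := inner_self_ne_zero.2 hv0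
  have ht : y = (inner ℂ x y / inner ℂ x x) • x := by
    rw [← sub_eq_zero, ← inner_self_eq_zero (𝕜 := ℂ)]
    simp only [inner_sub_left, inner_sub_right, inner_smul_left, inner_smul_right, map_div₀,
      inner_conj_symm]
    field_simp
    linear_combination hG
  have ht0 : inner ℂ x y / inner ℂ x x ≠ 0 := by
    intro h; rw [h, zero_smul] at ht; exact hy0 ht
  have hw : R' < ‖x + v‖ := by
    have : ‖x + v‖ * ‖x + v‖ = ‖x‖ * ‖x‖ + ‖v‖ * ‖v‖ := norm_add_sq_eq_norm_sq_add_norm_sq_of_inner_eq_zero x v hv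
    nlinarith [norm_nonneg v, norm_nonneg x, norm_nonneg (x + v)]
  have m1 : Mv R' x (x + v) := mv_two hR0' hx' hw (by
    simp only [inner_add_left, inner_add_right, hv, hv']
    intro h
    apply mul_ne_zero ixx ivv
    linear_combination h)
  have m2 : Mv R' (x + v) y := mv_two hR0' hw hy' (by
    generalize inner ℂ x y / inner ℂ x x = c at ht ht0
    subst ht
    simp only [inner_add_left, inner_add_right, hv, hv', inner_smul_left, inner_smul_right]
    intro h
    have hc : (starRingEnd ℂ) c ≠ 0 := by simpa using ht0
    apply mul_ne_zero (mul_ne_zero ht0 hc) (mul_ne_zero ixx ivv)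
    linear_combination h)
  exact m1.trans h1 m2

lemma connect (hn : 2 ≤ n) {R ε : ℝ} (hε : 0 < ε) {e : En n ≃ₜ En n}  {x y : En n}
    (hx : ‖x‖ ≤ R) (hy : ‖y‖ ≤ R) (ex : ∃ k, R < ‖e^[k] x‖) (ey : ∃ l, R < ‖e.symm^[l] y‖) :
    ∃ ψ ∈ Gam n, (∀ z ∈ closedBall (0 : En n) R, ‖ψ z - z‖ < ε ∧ ‖ψ.symm z - z‖ < ε) ∧
      ∃ m > 0, (ψ * e)^[m] x = y := by
  classical
  set k := Nat.find ex with hk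
  set l := Nat.find ey with hl
  have kx : R < ‖e^[k] x‖ := Nat.find_spec ex
  have ly : R < ‖e.symm^[l] y‖ := Nat.find_spec ey
  have kx' : ∀ i < k, ‖e^[i] x‖ ≤ R := fun i hi => not_lt.1 (Nat.find_min ex hi)
  have ly' : ∀ i < l, ‖e.symm^[i] y‖ ≤ R := fun i hi => not_lt.1 (Nat.find_min ey hi)
  have k0 : 0 < k := by
    rcases Nat.eq_zero_or_pos k with h | h
    · rw [h] at kx; simp at kx; linarith
    · exact h
  have hR0 : 0 ≤ R := (norm_nonneg _).trans hx
  obtain ⟨ψ, hψ, hf, hs, hm⟩ := mv_all hn hR0 kx ly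
    ((Finset.range k).image (fun i => e^[i] x) ∪ (Finset.range l).image (fun i => e.symm^[i] y)) (by
      intro s hs
      simp only [Finset.mem_union, Finset.mem_image, Finset.mem_range] at hs
      rcases hs with ⟨i, hi, rfl⟩ | ⟨i, hi, rfl⟩
      · exact kx' i hi
      · exact ly' i hi) ε hε
  have f1 : ∀ i < k, ψ (e^[i] x) = e^[i] x := fun i hi => hf _ (by
    simp only [Finset.mem_union, Finset.mem_image, Finset.mem_range]; exact Or.inl ⟨i, hi, rfl⟩)
  have f2 : ∀ i < l, ψ (e.symm^[i] y) = e.symm^[i] y := fun i hi => hf _ (by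
    simp only [Finset.mem_union, Finset.mem_image, Finset.mem_range]; exact Or.inr ⟨i, hi, rfl⟩)
  refine ⟨ψ, hψ, hs, l + k, by omega, ?_⟩
  have s1 : ∀ i < k, (ψ * e)^[i] x = e^[i] x := by
    intro i
    induction i with
    | zero => intro _; rfl
    | succ i ih =>
      intro hi
      rw [iterate_succ_apply', ih (by omega)]
      change ψ (e _) = _
      rw [← iterate_succ_apply' e, f1 _ hi]
  have s2 : (ψ * e)^[k] x = e.symm^[l] y := by
    obtain ⟨k', hk'⟩ := Nat.exists_eq_succ_of_ne_zero k0.ne'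
    rw [hk', Nat.succ_eq_add_one, iterate_succ_apply', s1 k' (by omega)]
    change ψ (e _) = _
    rw [← iterate_succ_apply' e, ← hm, hk']
  have s3 : ∀ m ≤ l, (ψ * e)^[m] (e.symm^[m] y) = y := by
    intro m
    induction m with
    | zero => intro _; rfl
    | succ m ih =>
      intro hm
      rw [iterate_succ_apply, iterate_succ_apply' e.symm]
      change (ψ * e)^[m] (ψ (e (e.symm _))) = _
      rw [e.apply_symm_apply, f2 m (by omega), ih (by omega)]
  rw [iterate_add_apply, s2, s3 l le_rfl]

/-- escape property -/
def Esc (n : ℕ) : Prop := ∀ N : Set (FS n), IsOpen N → ∀ e ∈ Gam n, iota e ∈ N →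
  ∀ U : Set (En n), IsOpen U → U.Nonempty → ∀ R : ℝ, ∃ e' ∈ Gam n, iota e' ∈ N ∧
    ∃ x ∈ U, ∃ k, R < ‖e'^[k] x‖

lemma iota_inv (e : En n ≃ₜ En n) : iota e⁻¹ = (iota e).swap := rfl

lemma esc_both (hE : Esc n) {N : Set (FS n)} (hN : IsOpen N) {e : En n ≃ₜ En n} (he : e ∈ Gam n)
    (heN : iota e ∈ N) {U : Set (En n)} (hU : IsOpen U) (hU0 : U.Nonempty) (R : ℝ) :
    ∃ U1 ⊆ U, IsOpen U1 ∧ U1.Nonempty ∧ ∀ V : Set (En n), IsOpen V → V.Nonempty → 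
      ∃ e' ∈ Gam n, iota e' ∈ N ∧ (∀ x ∈ U1, ∃ k, R < ‖e'^[k] x‖) ∧ ∃ y ∈ V, ∃ l, R < ‖e'.symm^[l] y‖ := by
  obtain ⟨e1, he1, he1N, x1, hx1, k, hk⟩ := hE N hN e he heN U hU hU0 R
  have hop : IsOpen {p : FS n × En n | R < ‖p.1.1^[k] p.2‖} := by
    have : Continuous fun p : FS n × En n => p.1.1^[k] p.2 :=
      (cont_iter k).comp ((continuous_fst.comp continuous_fst).prodMk continuous_snd)
    exact isOpen_lt continuous_const this.norm
  obtain ⟨A, B, hA, hB, hA1, hB1, hAB⟩ := isOpen_prod_iff.1 hop (iota e1) x1 hk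
  refine ⟨U ∩ B, inter_subset_left, hU.inter hB, ⟨x1, hx1, hB1⟩, fun V hV hV0 => ?_⟩
  obtain ⟨e2, he2, he2N, y, hy, l, hl⟩ := hE (Prod.swap ⁻¹' (N ∩ A)) ((hN.inter hA).preimage continuous_swap)
    e1⁻¹ (inv_mem he1) (by rw [iota_inv, mem_preimage, Prod.swap_swap]; exact ⟨he1N, hA1⟩) V hV hV0 R
  have h2 : iota e2⁻¹ ∈ N ∩ A := by rw [iota_inv]; exact he2N
  refine ⟨e2⁻¹, inv_mem he2, h2.1, fun x hx => ⟨k, ?_⟩, y, hy, l, hl⟩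
  have h3 : ((iota e2⁻¹, x) : FS n × En n) ∈ A ×ˢ B := Set.mk_mem_prod h2.2 hx.2
  have h4 := hAB h3
  rw [mem_setOf_eq] at h4
  exact h4

lemma dense_trans (hn : 2 ≤ n) (hE : Esc n) {N : Set (FS n)} (hN : IsOpen N) {e : En n ≃ₜ En n} (he : e ∈ Gam n)
    (heN : iota e ∈ N) {U V : Set (En n)} (hU : IsOpen U) (hU0 : U.Nonempty) (hV : IsOpen V) (hV0 : V.Nonempty) :
    ∃ e' ∈ Gam n, iota e' ∈ N ∧ ∃ x ∈ U, ∃ m, e'^[m] x ∈ V := by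
  obtain ⟨N', hN', heN', R, ε, hε, H⟩ := near_comp' hN heN
  obtain ⟨u, hu⟩ := hU0
  obtain ⟨v, hv⟩ := hV0
  set R' := max R (max (‖u‖ + 1) (‖v‖ + 1)) with hR'
  have hu' : ‖u‖ < R' := (lt_add_one _).trans_le ((le_max_left _ _).trans (le_max_right _ _))
  have hv' : ‖v‖ < R' := (lt_add_one _).trans_le ((le_max_right _ _).trans (le_max_right _ _))
  obtain ⟨U1, hU1, -, ⟨x, hx⟩, h⟩ := esc_both hE hN' he heN' (U := U ∩ ball 0 R') (hU.inter isOpen_ball)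
    ⟨u, hu, by simpa using hu'⟩ R'
  obtain ⟨e', he', he'N, h1, y, hy, h2⟩ := h (V ∩ ball 0 R') (hV.inter isOpen_ball) ⟨v, hv, by simpa using hv'⟩
  have hxR : ‖x‖ < R' := by simpa using (hU1 hx).2
  have hyR : ‖y‖ < R' := by simpa using hy.2
  obtain ⟨ψ, hψ, hs, m, -, hm⟩ := connect hn hε hxR.le hyR.le (h1 x hx) h2
  refine ⟨ψ * e', mul_mem hψ he', H _ _ he'N fun z hz => hs z (closedBall_subset_closedBall (le_max_left _ _) hz),
    x, (hU1 hx).1, m, ?_⟩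
  rw [hm]; exact hy.1

lemma dense_per (hn : 2 ≤ n) (hE : Esc n) {N : Set (FS n)} (hN : IsOpen N) {e : En n ≃ₜ En n} (he : e ∈ Gam n)
    (heN : iota e ∈ N) {U : Set (En n)} (hU : IsOpen U) (hU0 : U.Nonempty) :
    ∃ e' ∈ Gam n, iota e' ∈ N ∧ ∃ x ∈ U, ∃ m > 0, e'^[m] x = x := by
  obtain ⟨N', hN', heN', R, ε, hε, H⟩ := near_comp' hN heN
  obtain ⟨u, hu⟩ := hU0
  set R' := max R (‖u‖ + 1) with hR'
  have hu' : ‖u‖ < R' := (lt_add_one _).trans_le (le_max_right _ _)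
  obtain ⟨U1, hU1, hU1o, hU1n, h⟩ := esc_both hE hN' he heN' (U := U ∩ ball 0 R') (hU.inter isOpen_ball)
    ⟨u, hu, by simpa using hu'⟩ R'
  obtain ⟨e', he', he'N, h1, x, hx, h2⟩ := h U1 hU1o hU1n
  have hxR : ‖x‖ < R' := by simpa using (hU1 hx).2
  obtain ⟨ψ, hψ, hs, m, hm0, hm⟩ := connect hn hε hxR.le hxR.le (h1 x hx) h2
  exact ⟨ψ * e', mul_mem hψ he', H _ _ he'N fun z hz => hs z (closedBall_subset_closedBall (le_max_left _ _) hz),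
    x, (hU1 hx).1, m, hm0, hm⟩

end ChaosAux

namespace ChaosAux
open Polynomial

variable {n : ℕ}

lemma fderiv_lip {h : En n → En n} (hd : Differentiable ℂ h) {x : En n} {ρ M : ℝ} (hρ : 0 < ρ)
    (hM : ∀ y ∈ closedBall x (3 * ρ), ‖h y‖ ≤ M) {a b : En n} (ha : a ∈ closedBall x ρ)
    (hb : b ∈ closedBall x ρ) : ‖fderiv ℂ h b - fderiv ℂ h a‖ ≤ M / ρ ^ 2 * ‖b - a‖ := by
  have h2 : ∀ y ∈ closedBall x (2 * ρ), ‖fderiv ℂ h y‖ ≤ M / ρ := by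
    intro y hy
    refine cauchy_fderiv hd hρ fun z hz => hM z ?_
    rw [mem_closedBall] at *
    linarith [dist_triangle z y x]
  have hd2 : Differentiable ℂ (fun y => h (y + (b - a))) := 
    hd.comp (differentiable_id.add_const _)
  have h3 : fderiv ℂ (fun y => h (y + (b - a)) - h y) a = fderiv ℂ h b - fderiv ℂ h a := by
    rw [fderiv_fun_sub (hd2 a) (hd a), fderiv_comp_add_right, add_sub_cancel]
  rw [← h3]
  have := cauchy_fderiv (hd2.sub hd) (x := a) (ρ := ρ) (M := M / ρ * ‖b - a‖) hρ (by
    intro y hy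
    have hy1 : y ∈ closedBall x (2 * ρ) := by
      rw [mem_closedBall] at *
      linarith [dist_triangle y a x]
    have hy2 : y + (b - a) ∈ closedBall x (2 * ρ) := by
      rw [mem_closedBall] at *
      have : dist (y + (b - a)) b = dist y a := by
        rw [dist_eq_norm, dist_eq_norm]; congr 1; abel
      linarith [dist_triangle (y + (b - a)) b x]
    have := (convex_closedBall x (2 * ρ)).norm_image_sub_le_of_norm_fderiv_le (𝕜 := ℂ) (f := h)
      (fun y _ => hd y) h2 hy1 hy2
    simpa using this)
  calc _ ≤ _ := this
    _ = _ := by field_simp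

lemma taylor {h : En n → En n} (hd : Differentiable ℂ h) {x : En n} {ρ M : ℝ} (hρ : 0 < ρ)
    (hM : ∀ y ∈ closedBall x (3 * ρ), ‖h y‖ ≤ M) {a b : En n} (ha : a ∈ closedBall x ρ)
    (hb : b ∈ closedBall x ρ) : ‖h b - h a - fderiv ℂ h a (b - a)‖ ≤ M / ρ ^ 2 * ‖b - a‖ ^ 2 := by
  have hM0 : 0 ≤ M := (norm_nonneg _).trans (hM x (mem_closedBall_self (by positivity)))
  have := ((convex_closedBall x ρ).inter (convex_closedBall a ‖b - a‖)).norm_image_sub_le_of_norm_fderiv_le' 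
    (𝕜 := ℂ) (f := h) (φ := fderiv ℂ h a) (C := M / ρ ^ 2 * ‖b - a‖) (fun y _ => hd y) (by
      intro y hy
      refine (fderiv_lip hd hρ hM ha hy.1).trans ?_
      gcongr
      simpa [dist_eq_norm] using hy.2) (x := a) (y := b)
      ⟨ha, mem_closedBall_self (norm_nonneg _)⟩ ⟨hb, by simp [dist_eq_norm]⟩
  rw [pow_two ‖b - a‖, ← mul_assoc]
  exact this

lemma fderiv_cont {h : En n → En n} (hd : Differentiable ℂ h) : Continuous (fderiv ℂ h) := by
  rw [continuous_iff_continuousAt]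
  intro x
  obtain ⟨M, hM⟩ := (isCompact_closedBall x (3 * 1)).exists_bound_of_continuousOn hd.continuous.continuousOn
  have h1 : ∀ᶠ y in 𝓝 x, ‖fderiv ℂ h y - fderiv ℂ h x‖ ≤ M / 1 ^ 2 * ‖y - x‖ := by
    filter_upwards [closedBall_mem_nhds x one_pos] with y hy
    exact fderiv_lip hd one_pos hM (mem_closedBall_self zero_le_one) hy
  rw [ContinuousAt, tendsto_iff_norm_sub_tendsto_zero]
  refine squeeze_zero' (Eventually.of_forall fun _ => norm_nonneg _) h1 ?_
  have : Tendsto (fun y => M / 1 ^ 2 * ‖y - x‖) (𝓝 x) (𝓝 (M / 1 ^ 2 * ‖x - x‖)) := by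
    apply Continuous.tendsto; fun_prop
  simpa using this

lemma quant_inv {h : En n → En n} (hd : Differentiable ℂ h) {p : En n} {r K : ℝ} (hr : 0 ≤ r) (hK : 0 < K)
    {A B : En n →L[ℂ] En n} (hAB : ∀ y, A (B y) = y) (hB : ‖B‖ ≤ K)
    (hA : ∀ x ∈ closedBall p r, ‖fderiv ℂ h x - A‖ ≤ 1 / (2 * K)) {y : En n} (hy : ‖y - h p‖ ≤ r / (2 * K)) :
    ∃ x ∈ closedBall p r, h x = y := by
  lift K to NNReal using hK.le
  have hap : ApproximatesLinearOn h A (closedBall p r) (1 / (2 * K)) := by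
    intro x hx z hz
    have := (convex_closedBall p r).norm_image_sub_le_of_norm_fderiv_le' (𝕜 := ℂ) (f := h) (φ := A)
      (fun y _ => hd y) hA hz hx
    simpa using this
  let S : A.NonlinearRightInverse := ⟨B, K, fun y => (B.le_opNorm y).trans (by gcongr), hAB⟩
  have := hap.surjOn_closedBall_of_nonlinearRightInverse S hr subset_rfl
  obtain ⟨x, hx, hxy⟩ := this (a := y) (by
    rw [mem_closedBall, dist_eq_norm]
    refine hy.trans (le_of_eq ?_)
    change r / (2 * K) = ((K : ℝ)⁻¹ - ((1 / (2 * K) : NNReal) : ℝ)) * r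
    push_cast
    field_simp
    ring)
  exact ⟨x, hx, hxy⟩

/-- iterates in C -/
def itc (k : ℕ) (f : C(En n, En n)) : C(En n, En n) := ⟨f^[k], f.continuous.iterate k⟩

lemma itc_cont (k : ℕ) : Continuous (itc (n := n) k) := by
  induction k with
  | zero => exact continuous_const (y := ContinuousMap.id _)
  | succ k ih =>
    exact (ContinuousMap.continuous_comp'.comp (continuous_id.prodMk ih))

lemma persist {e : En n ≃ₜ En n} (he : Differentiable ℂ e) {K : ℕ} {p : En n} (hp : e^[K] p = p) 
    {U : Set (En n)} (hU : IsOpen U) (hpU : p ∈ U)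
    (hker : LinearMap.ker ((fderiv ℂ (e^[K]) p - 1 : En n →L[ℂ] En n) : En n →ₗ[ℂ] En n) = ⊥) :
    ∃ W ∈ 𝓝 (iota e), ∀ w ∈ W, Differentiable ℂ w.1 → ∃ p' ∈ U, w.1^[K] p' = p' := by
  set T : En n →L[ℂ] En n := fderiv ℂ (e^[K]) p - 1 with hT
  have hinj : Injective (T : En n →ₗ[ℂ] En n) := LinearMap.ker_eq_bot.1 hker
  let eq : En n ≃L[ℂ] En n := (LinearEquiv.ofInjectiveEndo (T : En n →ₗ[ℂ] En n) hinj).toContinuousLinearEquiv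
  let B : En n →L[ℂ] En n := eq.symm
  have hTB : ∀ y, T (B y) = y := fun y => eq.apply_symm_apply y
  have hF0 : Differentiable ℂ (e^[K]) := he.iterate K
  set C := ‖B‖ + 1 with hC
  have hC0 : 0 < C := by positivity
  have hcont := Metric.continuousAt_iff.1 ((fderiv_cont hF0).continuousAt (x := p)) (1 / (4 * C)) (by positivity)
  obtain ⟨r1, hr1, H1⟩ := hcont
  obtain ⟨r2, hr2, H2⟩ := Metric.isOpen_iff.1 hU p hpU
  set r := min r1 r2 / 2 with hr
  have hr0 : 0 < r := by positivity
  have hrr1 : r < r1 := by have := min_le_left r1 r2; have : 0 < min r1 r2 := by positivity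
                           linarith
  have hrr2 : r < r2 := by have := min_le_right r1 r2; have : 0 < min r1 r2 := by positivity
                           linarith
  set δ := min (r / (4 * C)) (r / (2 * C)) with hδ
  have hδ0 : 0 < δ := by positivity
  have hnb := nhds_ball (itc K (iota e).1) (‖p‖ + 2 * r) hδ0
  have hnb2 := (itc_cont K).continuousAt.preimage_mem_nhds hnb
  have hnb3 := (continuous_fst (X := C(En n, En n)) (Y := C(En n, En n))).continuousAt.preimage_mem_nhds
    (x := iota e) hnb2
  refine ⟨_, hnb3, fun w hw hwd => ?_⟩
  have hw : ∀ z ∈ closedBall (0 : En n) (‖p‖ + 2 * r), ‖w.1^[K] z - e^[K] z‖ < δ := hw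
  have hG : Differentiable ℂ (w.1^[K]) := hwd.iterate K
  have hw2 : ∀ z ∈ closedBall p (2 * r), ‖w.1^[K] z - e^[K] z‖ ≤ δ := fun z hz => (hw z (by
    rw [mem_closedBall, dist_zero_right]
    rw [mem_closedBall, dist_eq_norm] at hz
    linarith [norm_le_norm_add_norm_sub' z p])).le
  obtain ⟨x, hx, hx0⟩ := quant_inv (h := fun z => w.1^[K] z - z) (hG.sub differentiable_id) (p := p) hr0.le hC0
    hTB (by linarith) (by
      intro x hx
      have e1 : fderiv ℂ (fun z => w.1^[K] z - z) x - T = 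
        fderiv ℂ (fun z => w.1^[K] z - e^[K] z) x + (fderiv ℂ (e^[K]) x - fderiv ℂ (e^[K]) p) := by
        rw [fderiv_fun_sub (hG x) differentiableAt_fun_id, fderiv_fun_sub (hG x) (hF0 x), hT]
        rw [fderiv_fun_id]
        change _ - 1 - _ = _
        abel
      rw [e1]
      have b1 : ‖fderiv ℂ (fun z => w.1^[K] z - e^[K] z) x‖ ≤ δ / r := 
        cauchy_fderiv (hG.sub hF0) hr0 fun y hy => hw2 y (by
          rw [mem_closedBall] at *
          linarith [dist_triangle y x p])
      have b2 : ‖fderiv ℂ (e^[K]) x - fderiv ℂ (e^[K]) p‖ ≤ 1 / (4 * C) := by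
        rw [← dist_eq_norm]
        exact (H1 (lt_of_le_of_lt hx hrr1)).le
      have b3 : δ / r ≤ 1 / (4 * C) := by
        rw [div_le_iff₀ hr0]
        refine (min_le_left _ _).trans (le_of_eq ?_)
        field_simp
      calc _ ≤ _ := norm_add_le _ _
        _ ≤ 1 / (4 * C) + 1 / (4 * C) := by linarith
        _ = _ := by field_simp; norm_num) (y := 0) (by
      have := hw2 p (mem_closedBall_self (by positivity))
      rw [hp] at this
      rw [zero_sub, norm_neg]
      exact this.trans (min_le_right _ _))
  exact ⟨x, H2 (lt_of_le_of_lt hx hrr2), sub_eq_zero.1 hx0⟩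

lemma nondeg_step (hn : 2 ≤ n) {N : Set (FS n)} (hN : IsOpen N) {e : En n ≃ₜ En n} (he : e ∈ Gam n)
    (heN : iota e ∈ N) {p : En n} {K : ℕ} (hK : 0 < K) (hp : e^[K] p = p) (hmin : ∀ i, 0 < i → i < K → e^[i] p ≠ p)
    (hker : LinearMap.ker ((fderiv ℂ (e^[K]) p - 1 : En n →L[ℂ] En n) : En n →ₗ[ℂ] En n) ≠ ⊥) :
    ∃ e' ∈ Gam n, iota e' ∈ N ∧ e'^[K] p = p ∧ (∀ i, 0 < i → i < K → e'^[i] p ≠ p) ∧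
      LinearMap.ker ((fderiv ℂ (e'^[K]) p - 1 : En n →L[ℂ] En n) : En n →ₗ[ℂ] En n) <
      LinearMap.ker ((fderiv ℂ (e^[K]) p - 1 : En n →L[ℂ] En n) : En n →ₗ[ℂ] En n) := by
  classical
  set D := fderiv ℂ (e^[K]) p with hD
  set T : En n →ₗ[ℂ] En n := ((D - 1 : En n →L[ℂ] En n) : En n →ₗ[ℂ] En n) with hT
  obtain ⟨w, hw, hw0⟩ := Submodule.exists_mem_ne_zero_of_ne_bot hker
  have hTa : ∀ v, T v = D v - v := fun v => rfl
  have hr : ∃ r : En n, r ≠ 0 ∧ (LinearMap.range T ≠ ⊥ → r ∈ LinearMap.range T) := by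
    by_cases h : LinearMap.range T = ⊥
    · exact ⟨w, hw0, fun h' => absurd h h'⟩
    · obtain ⟨r, hr, hr0⟩ := Submodule.exists_mem_ne_zero_of_ne_bot h
      exact ⟨r, hr0, fun _ => hr⟩
  obtain ⟨r, hr0, hr⟩ := hr
  let S : Finset ℕ := Finset.Ioo 0 K
  obtain ⟨ℓ', hℓ'⟩ := Module.exists_dual_forall_apply_ne_zero (K := ℂ) (ι := Option (Option S))
    (fun o => match o with
      | none => w
      | some none => r
      | some (some i) => p - e^[i.1] p) (by
      rintro (_ | _ | i)
      · exact hw0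
      · exact hr0
      · have := Finset.mem_Ioo.1 i.2
        exact sub_ne_zero.2 (hmin i.1 this.1 this.2).symm)
  let ℓ : En n →L[ℂ] ℂ := LinearMap.toContinuousLinearMap ℓ'
  have hℓw : ℓ w ≠ 0 := hℓ' none
  have hℓr : ℓ r ≠ 0 := hℓ' (some none)
  have hℓp : ∀ i, 0 < i → i < K → ℓ p ≠ ℓ (e^[i] p) := by
    intro i h1 h2 h3
    have : ℓ (p - e^[i] p) ≠ 0 := hℓ' (some (some ⟨i, Finset.mem_Ioo.2 ⟨h1, h2⟩⟩))
    rw [map_sub, h3, sub_self] at this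
    exact this rfl
  have hb : ∃ b, ℓ b = 0 ∧ b ∉ LinearMap.range T := by
    by_contra! hcon
    have hle : LinearMap.ker (ℓ : En n →ₗ[ℂ] ℂ) ≤ LinearMap.range T := fun b hb => hcon b hb
    have hrk := LinearMap.finrank_range_add_finrank_ker T
    have hrk2 := LinearMap.finrank_range_add_finrank_ker (ℓ : En n →ₗ[ℂ] ℂ)
    have h1 : Module.finrank ℂ (LinearMap.range (ℓ : En n →ₗ[ℂ] ℂ)) ≤ 1 := by
      simpa using Submodule.finrank_le (LinearMap.range (ℓ : En n →ₗ[ℂ] ℂ))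
    have h2 : 0 < Module.finrank ℂ (LinearMap.ker T) := by
      rw [Module.finrank_pos_iff, Submodule.nontrivial_iff_ne_bot]; exact hker
    have heq := Submodule.eq_of_le_of_finrank_le hle (by omega)
    obtain ⟨b, hb0, hb⟩ := exists_ker hn ℓ
    have hne : LinearMap.range T ≠ ⊥ := by
      intro h
      have : b ∈ LinearMap.range T := hle hb
      rw [h] at this
      exact hb0 (by simpa using this)
    have := hr hne
    rw [← heq] at this
    exact hℓr this
  obtain ⟨b, hbℓ, hbT⟩ := hb
  set Q : ℂ[X] := ∏ i ∈ S, (X - C (ℓ (e^[i] p))) ^ 2 with hQ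
  set q : ℂ[X] := (X - C (ℓ p)) * Q with hq
  obtain ⟨t0, ht0, Ht⟩ := small_shear hN heN ℓ b hbℓ q
  set t : ℂ := (t0 : ℂ) with ht
  have ht' : t ≠ 0 := by rw [ht]; exact_mod_cast ht0.ne'
  have htN := Ht t (by rw [ht]; simp [abs_of_pos ht0])
  set ψ := sh ℓ b hbℓ (C t * q) with hψ
  set e' := ψ * e with he'
  have hQi : ∀ i ∈ S, ∃ P : ℂ[X], q = (X - C (ℓ (e^[i] p))) ^ 2 * P := by
    intro i hi
    refine ⟨(X - C (ℓ p)) * ∏ j ∈ S.erase i, (X - C (ℓ (e^[j] p))) ^ 2, ?_⟩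
    rw [hq, hQ, ← Finset.mul_prod_erase S _ hi]; ring
  have hψder : ∀ y, HasFDerivAt ψ (ContinuousLinearMap.id ℂ (En n) +
      ((C t * q).derivative.eval (ℓ y) • ℓ).smulRight b) y := fun y => shFun_hasFDerivAt ℓ b _ y
  have hψi : ∀ i, 0 < i → i < K → ψ (e^[i] p) = e^[i] p ∧ HasFDerivAt ψ (ContinuousLinearMap.id ℂ (En n)) (e^[i] p) := by
    intro i h1 h2
    obtain ⟨P, hP⟩ := hQi i (Finset.mem_Ioo.2 ⟨h1, h2⟩)
    constructor
    · rw [hψ, sh_apply, hP]; simp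
    · have := hψder (e^[i] p)
      rw [hP] at this
      refine this.congr_fderiv ?_
      ext1 v
      simp [derivative_mul, derivative_pow]
  have hψp : ψ p = p := by rw [hψ, sh_apply, hq]; simp
  have hed : Differentiable ℂ e := (Gam.good he).1.diff
  have hit : ∀ i < K, e'^[i] p = e^[i] p ∧ HasFDerivAt (e'^[i]) (fderiv ℂ (e^[i]) p) p := by
    intro i
    induction i with
    | zero => 
      intro _
      refine ⟨rfl, ?_⟩
      exact ((differentiable_id (𝕜 := ℂ) (E := En n)) p).hasFDerivAt
    | succ i ih =>
      intro hi
      obtain ⟨i1, i2⟩ := ih (by omega)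
      obtain ⟨j1, j2⟩ := hψi (i+1) (by omega) hi
      constructor
      · rw [iterate_succ_apply', i1]
        change ψ (e _) = _
        rw [← iterate_succ_apply' e, j1]
      · rw [iterate_succ']
        have h1 : HasFDerivAt (e' ∘ e'^[i]) _ p := HasFDerivAt.comp p (g := e') (f := e'^[i]) (by
          rw [i1]
          exact HasFDerivAt.comp (e^[i] p) (g := ψ) (f := e) (by
            rw [← iterate_succ_apply' e]; exact j2) (hed _).hasFDerivAt) i2
        refine h1.congr_fderiv ?_
        rw [iterate_succ', fderiv_comp p (hed _) (hed.iterate i p)]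
        rfl
  obtain ⟨K', rfl⟩ := Nat.exists_eq_succ_of_ne_zero hK.ne'
  obtain ⟨i1, i2⟩ := hit K' (by omega)
  have hpK : e (e^[K'] p) = p := by rw [← iterate_succ_apply' e]; exact hp
  set c := (C t * q).derivative.eval (ℓ p) with hc
  have hc0 : c ≠ 0 := by
    have : c = t * Q.eval (ℓ p) := by
      rw [hc, hq]; simp [derivative_mul]
    rw [this]
    refine mul_ne_zero ht' ?_
    rw [hQ, eval_prod, Finset.prod_ne_zero_iff]
    intro i hi
    have := Finset.mem_Ioo.1 hi
    simpa using sub_ne_zero.2 (hℓp i this.1 this.2)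
  have hD' : ∀ v, fderiv ℂ (e'^[K'.succ]) p v = D v + (c * ℓ (D v)) • b := by
    have h1 : HasFDerivAt (e' ∘ e'^[K']) _ p := HasFDerivAt.comp p (g := e') (f := e'^[K']) (by
          rw [i1]
          exact HasFDerivAt.comp (e^[K'] p) (g := ψ) (f := e) (by
            rw [hpK]; exact hψder p) (hed _).hasFDerivAt) i2
    rw [Nat.succ_eq_add_one, iterate_succ', h1.fderiv]
    have h2 : D = (fderiv ℂ e (e^[K'] p)).comp (fderiv ℂ (e^[K']) p) := by
      rw [hD, Nat.succ_eq_add_one, iterate_succ', fderiv_comp p (hed _) (hed.iterate K' p)]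
    intro v
    rw [h2]
    simp [hc]
  refine ⟨e', mul_mem (sh_mem _ _ _ _) he, htN, ?_, ?_, ?_⟩
  · rw [Nat.succ_eq_add_one, iterate_succ_apply', i1]
    change ψ (e _) = _
    rw [hpK, hψp]
  · intro i h1 h2
    rw [(hit i h2).1]
    exact hmin i h1 h2
  · have key : ∀ v, fderiv ℂ (e'^[K'.succ]) p v - v = 0 → D v - v = 0 ∧ ℓ v = 0 := by
      intro v hv
      rw [hD'] at hv
      have h1 : (c * ℓ (D v)) = 0 := by
        by_contra hne
        apply hbT
        refine ⟨(-(c * ℓ (D v))⁻¹) • v, ?_⟩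
        rw [map_smul, hTa]
        have : D v - v = - ((c * ℓ (D v)) • b) := by
          rw [eq_neg_iff_add_eq_zero, ← hv]; abel
        rw [this, smul_neg, neg_smul, neg_neg, smul_smul, inv_mul_cancel₀ hne, one_smul]
      rw [h1, zero_smul, add_zero] at hv
      refine ⟨hv, ?_⟩
      have := (mul_eq_zero.1 h1).resolve_left hc0
      rwa [sub_eq_zero.1 hv] at this
    rw [SetLike.lt_iff_le_and_exists]
    refine ⟨fun v hv => (key v hv).1, w, hw, fun h => hℓw (key w h).2⟩

lemma nondeg (hn : 2 ≤ n) {N : Set (FS n)} (hN : IsOpen N) {p : En n} {K : ℕ} (hK : 0 < K) :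
    ∀ (d : ℕ) (e : En n ≃ₜ En n), e ∈ Gam n → iota e ∈ N → e^[K] p = p → (∀ i, 0 < i → i < K → e^[i] p ≠ p) →
      Module.finrank ℂ (LinearMap.ker ((fderiv ℂ (e^[K]) p - 1 : En n →L[ℂ] En n) : En n →ₗ[ℂ] En n)) = d →
    ∃ e' ∈ Gam n, iota e' ∈ N ∧ e'^[K] p = p ∧ 
      LinearMap.ker ((fderiv ℂ (e'^[K]) p - 1 : En n →L[ℂ] En n) : En n →ₗ[ℂ] En n) = ⊥ := by
  intro d
  induction d using Nat.strong_induction_on with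
  | _ d ih =>
    intro e he heN hp hmin hd
    by_cases hker : LinearMap.ker ((fderiv ℂ (e^[K]) p - 1 : En n →L[ℂ] En n) : En n →ₗ[ℂ] En n) = ⊥
    · exact ⟨e, he, heN, hp, hker⟩
    · obtain ⟨e', he', he'N, hp', hmin', hlt⟩ := nondeg_step hn hN he heN hK hp hmin hker
      exact ih _ (hd ▸ Submodule.finrank_lt_finrank_of_lt hlt) e' he' he'N hp' hmin' rfl

end ChaosAux

namespace ChaosAux
open Polynomial

variable {n : ℕ}

lemma exists_generic (O : ℕ → Set (FS n)) (hO : ∀ i, IsOpen (O i)) 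
    (hd : ∀ i, ∀ N : Set (FS n), IsOpen N → ∀ e ∈ Gam n, iota e ∈ N → ∃ w ∈ XS n, w ∈ N ∧ w ∈ O i) :
    ∃ w ∈ XS n, ∀ i, w ∈ O i := by
  have h1 : ∀ i, IsOpen ((Subtype.val : XS n → FS n) ⁻¹' (O i)) := fun i => (hO i).preimage continuous_subtype_val
  have h2 : ∀ i, Dense ((Subtype.val : XS n → FS n) ⁻¹' (O i)) := by
    intro i
    rw [dense_iff_inter_open]
    rintro V hV ⟨v, hv⟩
    obtain ⟨N, hN, rfl⟩ := isOpen_induced_iff.1 hV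
    obtain ⟨_, hN2, e, he, rfl⟩ := mem_closure_iff.1 v.2 N hN hv
    obtain ⟨w, hw, hwN, hwO⟩ := hd i N hN e he hN2
    exact ⟨⟨w, hw⟩, hwN, hwO⟩
  have : Nonempty (XS n) := ⟨⟨iota 1, subset_closure ⟨1, one_mem _, rfl⟩⟩⟩
  obtain ⟨w, hw⟩ := (dense_iInter_of_isOpen h1 h2).nonempty
  exact ⟨w.1, w.2, fun i => mem_iInter.1 hw i⟩

lemma XS_mem {e : En n ≃ₜ En n} (he : e ∈ Gam n) : iota e ∈ XS n := subset_closure ⟨e, he, rfl⟩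

/-- transitive sets -/
def OT (U V : Set (En n)) : Set (FS n) := {w | ∃ x ∈ U, ∃ k, w.1^[k] x ∈ V}

lemma OT_open {U V : Set (En n)} (hV : IsOpen V) : IsOpen (OT U V) := by
  have : OT U V = ⋃ x ∈ U, ⋃ k : ℕ, (fun w : FS n => w.1^[k] x) ⁻¹' V := by
    ext w; simp [OT]
  rw [this]
  refine isOpen_biUnion fun x _ => isOpen_iUnion fun k => hV.preimage ?_
  exact (cont_iter k).comp (continuous_fst.prodMk continuous_const)

/-- periodic sets -/
def OP (U : Set (En n)) : Set (FS n) :=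
  ⋃ W ∈ {W : Set (FS n) | IsOpen W ∧ ∀ w ∈ W, w ∈ XS n → ∃ p ∈ U, ∃ k, 0 < k ∧ w.1^[k] p = p}, W

theorem main_of_esc (hn : 2 ≤ n) (hE : Esc n) : ∃ f : En n → En n, IsHoloAut f ∧ IsVolPres f ∧ Chaotic f := by
  classical
  have : Nonempty (En n) := ⟨0⟩
  obtain ⟨B, hB⟩ : ∃ B : ℕ → Set (En n), (∀ i, IsOpen (B i) ∧ (B i).Nonempty) ∧
      ∀ U : Set (En n), IsOpen U → U.Nonempty → ∃ i, B i ⊆ U := by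
    have hbas := TopologicalSpace.isBasis_countableBasis (En n)
    have hc := TopologicalSpace.countable_countableBasis (En n)
    have hne : (TopologicalSpace.countableBasis (En n)).Nonempty := by
      obtain ⟨V, hV, -⟩ := hbas.exists_subset_of_mem_open (mem_univ (0 : En n)) isOpen_univ
      exact ⟨V, hV⟩
    obtain ⟨B, hB⟩ := hc.exists_eq_range hne
    refine ⟨B, fun i => ?_, fun U hU hU0 => ?_⟩
    · have hi : B i ∈ TopologicalSpace.countableBasis (En n) := by rw [hB]; exact ⟨i, rfl⟩
      exact ⟨hbas.isOpen hi, TopologicalSpace.nonempty_of_mem_countableBasis hi⟩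
    · obtain ⟨u, hu⟩ := hU0
      obtain ⟨V, hV, -, hVU⟩ := hbas.exists_subset_of_mem_open hu hU
      rw [hB] at hV
      obtain ⟨i, rfl⟩ := hV
      exact ⟨i, hVU⟩
  obtain ⟨hB1, hB2⟩ := hB
  let O : ℕ → Set (FS n) := fun i => OT (B i.unpair.1) (B i.unpair.2) ∩ OP (B i.unpair.1)
  have hOP : ∀ U : Set (En n), IsOpen (OP U) := fun U => isOpen_biUnion fun W hW => hW.1
  obtain ⟨w, hw, hwO⟩ := exists_generic O (fun i => (OT_open (hB1 _).1).inter (hOP _)) (by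
    intro i N hN e he heN
    obtain ⟨e1, he1, he1N, x, hx, m, hm⟩ := dense_trans hn hE hN he heN (hB1 i.unpair.1).1 (hB1 i.unpair.1).2
      (hB1 i.unpair.2).1 (hB1 i.unpair.2).2
    have he1O : iota e1 ∈ N ∩ OT (B i.unpair.1) (B i.unpair.2) := ⟨he1N, x, hx, m, hm⟩
    have hop := hN.inter (OT_open (U := B i.unpair.1) (hB1 i.unpair.2).1)
    obtain ⟨e2, he2, he2N, p, hp, hm⟩ := dense_per hn hE hop he1 he1O (hB1 i.unpair.1).1 (hB1 i.unpair.1).2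
    have hK := Nat.find_spec hm
    have hKm : ∀ j, 0 < j → j < Nat.find hm → e2^[j] p ≠ p := fun j h1 h2 h3 => Nat.find_min hm h2 ⟨h1, h3⟩
    obtain ⟨e3, he3, he3N, hp3, hker⟩ := nondeg hn hop hK.1 _ e2 he2 he2N hK.2 hKm rfl
    obtain ⟨W, hW, hWp⟩ := persist (Gam.good he3).1.diff hp3 (hB1 i.unpair.1).1 hp hker
    obtain ⟨W', hW'W, hW'o, hW'e⟩ := mem_nhds_iff.1 hW
    refine ⟨iota e3, XS_mem he3, he3N.1, he3N.2, ?_⟩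
    refine mem_biUnion (x := W') ⟨hW'o, fun w hw hwX => ?_⟩ hW'e
    obtain ⟨p', hp', hk⟩ := hWp w (hW'W hw) (XS_prop hwX).1
    exact ⟨p', hp', _, hK.1, hk⟩)
  obtain ⟨h1, h2, h3, h4, h5⟩ := XS_prop hw
  refine ⟨w.1, ⟨h1, w.2, h2, h3, h4⟩, h5, ?_, ?_⟩
  · have hd : ∀ i, Dense (⋃ k : ℕ, w.1^[k] ⁻¹' (B i)) := by
      intro i
      rw [dense_iff_inter_open]
      intro U hU hU0
      obtain ⟨j, hj⟩ := hB2 U hU hU0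
      have := (hwO (Nat.pair j i)).1
      simp only [Nat.unpair_pair] at this
      obtain ⟨x, hx, k, hk⟩ := this
      exact ⟨x, hj hx, mem_iUnion.2 ⟨k, hk⟩⟩
    obtain ⟨x, hx⟩ := (dense_iInter_of_isOpen (fun i => isOpen_iUnion fun k => 
      (hB1 i).1.preimage (w.1.continuous.iterate k)) hd).nonempty
    refine ⟨x, ?_⟩
    rw [dense_iff_inter_open]
    intro U hU hU0
    obtain ⟨j, hj⟩ := hB2 U hU hU0
    obtain ⟨k, hk⟩ := mem_iUnion.1 (mem_iInter.1 hx j)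
    exact ⟨_, hj hk, k, rfl⟩
  · rw [dense_iff_inter_open]
    intro U hU hU0
    obtain ⟨j, hj⟩ := hB2 U hU hU0
    have := (hwO (Nat.pair j j)).2
    simp only [Nat.unpair_pair] at this
    obtain ⟨W, hW, hwW⟩ := mem_iUnion₂.1 this
    obtain ⟨p, hp, hk⟩ := hW.2 w hwW hw
    exact ⟨p, hj hp, hk⟩

end ChaosAux

namespace ChaosAux
open Polynomial

variable {n : ℕ}

lemma detinv (n : ℕ) (C : ℝ) : ∃ C' > 0, ∀ A B : En n →L[ℂ] En n, (∀ y, A (B y) = y) → A.det = 1 → ‖A‖ ≤ C → 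
    ‖B‖ ≤ C' := by
  have : ProperSpace (En n →L[ℂ] En n) := FiniteDimensional.proper ℂ _
  have hcpt : IsCompact (({A : En n →L[ℂ] En n | A.det = 1} ∩ closedBall 0 C) ×ˢ (sphere (0 : En n) 1)) := by
    refine IsCompact.prod ?_ (isCompact_sphere _ _)
    exact (isCompact_closedBall _ _).inter_left (isClosed_eq continuous_det continuous_const)
  have hc : Continuous fun p : (En n →L[ℂ] En n) × En n => ‖p.1 p.2‖ := by fun_prop
  obtain ⟨m, hm0, hm⟩ := hcpt.exists_forall_le' hc.continuousOn (a := 0) (by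
    rintro ⟨A, v⟩ ⟨⟨hA, -⟩, hv⟩
    have hA : A.det = 1 := hA
    have hv : ‖v‖ = 1 := by simpa using hv
    rw [norm_pos_iff]
    intro h0
    have hu : IsUnit (LinearMap.det (A : En n →ₗ[ℂ] En n)) := by
      change IsUnit A.det
      rw [hA]; exact isUnit_one
    have hk := LinearMap.ker_eq_bot.1 ((LinearMap.isUnit_iff_ker_eq_bot _).1 ((LinearMap.isUnit_iff_isUnit_det _).2 hu))
    have : v = 0 := hk (by simpa using h0)
    rw [this] at hv; simp at hv)
  refine ⟨m⁻¹, by positivity, fun A B hAB hA hAC => ContinuousLinearMap.opNorm_le_bound _ (by positivity) fun y => ?_⟩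
  by_cases hB : B y = 0
  · rw [hB, norm_zero]; positivity
  have hBp : 0 < ‖B y‖ := norm_pos_iff.2 hB
  have h1 := hm (A, ((‖B y‖⁻¹ : ℝ) : ℂ) • B y) ⟨⟨hA, by simpa using hAC⟩, by
    simp [norm_smul]; field_simp⟩
  simp only [map_smul, hAB, norm_smul] at h1
  simp at h1
  rw [inv_mul_eq_div, le_div_iff₀ hBp] at h1
  rw [inv_mul_eq_div, le_div_iff₀ hm0]
  linarith

/-- trace -/
def tr (A : En n →L[ℂ] En n) : ℂ := ∑ i, (A (EuclideanSpace.single i 1)) i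

lemma det_eq (A : En n →L[ℂ] En n) : A.det = Matrix.det (Matrix.of fun i j : Fin n => (A (EuclideanSpace.single j 1)) i) := by
  rw [ContinuousLinearMap.det, ← LinearMap.det_toMatrix (EuclideanSpace.basisFun (Fin n) ℂ).toBasis]
  congr 1

lemma trace_bound (n : ℕ) : ∃ K > 0, ∃ δ > 0, ∀ A : En n →L[ℂ] En n, ‖A‖ ≤ δ → (1 + A).det = 1 → ‖tr A‖ ≤ K * ‖A‖ ^ 2 := by
  let P : (En n →L[ℂ] En n) → ℂ := fun A => (1 + A).det
  have hentry : ∀ i j : Fin n, ContDiff ℂ 2 (fun A : En n →L[ℂ] En n => (A (EuclideanSpace.single j (1:ℂ))) i) := by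
    intro i j
    exact ((EuclideanSpace.proj i : En n →L[ℂ] ℂ).comp 
      (ContinuousLinearMap.apply ℂ (En n) (EuclideanSpace.single j (1:ℂ)))).contDiff
  have hP : ContDiff ℂ 2 P := by
    have : P = fun A => ∑ σ : Equiv.Perm (Fin n), (Equiv.Perm.sign σ : ℂ) * ∏ i, ((1 + A) (EuclideanSpace.single i 1)) (σ i) := by
      ext A
      simp only [P, det_eq, Matrix.det_apply', Matrix.of_apply]
    rw [this]
    refine ContDiff.sum fun σ _ => contDiff_const.mul (contDiff_prod fun i _ => ?_)
    exact (hentry (σ i) i).comp (contDiff_const.add contDiff_id)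
  have hP0 : P 0 = 1 := by simp [P, ContinuousLinearMap.det]
  have hder : ∀ A, fderiv ℂ P 0 A = tr A := by
    intro A
    have h1 : HasDerivAt (fun t : ℂ => P (t • A)) (fderiv ℂ P 0 A) 0 := by
      have h2 : HasDerivAt (fun t : ℂ => t • A) A 0 := by simpa using (hasDerivAt_id (0:ℂ)).smul_const A
      have h3 : HasFDerivAt P (fderiv ℂ P 0) ((0:ℂ) • A) := by
        have e0 : (0:ℂ) • A = 0 := by ext; simp
        rw [e0]; exact (hP.differentiable (by norm_num) 0).hasFDerivAt
      exact h3.comp_hasDerivAt 0 h2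
    set M : Matrix (Fin n) (Fin n) ℂ := Matrix.of fun i j : Fin n => (A (EuclideanSpace.single j 1)) i with hM
    have h4 : ∀ t : ℂ, P (t • A) = (1 + t • M).det := by
      intro t
      simp only [P, det_eq]
      congr 1
      ext i j
      simp [hM, Matrix.one_apply, eq_comm]
    have h5 : ∀ t : ℂ, P (t • A) = 1 + M.trace * t + ((1 + (X : ℂ[X]) • M.map C).det.divX.divX).eval t * t ^ 2 := by
      intro t
      rw [h4, Matrix.det_one_add_smul]
    set Q := (1 + (X : ℂ[X]) • M.map C).det.divX.divX
    have h6 : HasDerivAt (fun t : ℂ => P (t • A)) M.trace 0 := by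
      have e : (fun t : ℂ => P (t • A)) = fun t => (1 + C M.trace * X + Q * X ^ 2 : ℂ[X]).eval t := by
        ext t; rw [h5]; simp
      rw [e]
      exact ((1 + C M.trace * X + Q * X ^ 2 : ℂ[X]).hasDerivAt 0).congr_deriv (by simp)
    rw [h1.unique h6, Matrix.trace, tr]
    rfl
  obtain ⟨K, S, hS, hL⟩ := ((hP.fderiv_right (m := 1) (by norm_num)).contDiffAt (x := 0)).exists_lipschitzOnWith
  obtain ⟨δ, hδ, hδS⟩ := Metric.nhds_basis_closedBall.mem_iff.1 hS
  refine ⟨K + 1, by positivity, δ, hδ, fun A hA hdet => ?_⟩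
  have := (convex_closedBall (0 : En n →L[ℂ] En n) ‖A‖).norm_image_sub_le_of_norm_fderiv_le' (𝕜 := ℂ) (f := P)
    (φ := fderiv ℂ P 0) (C := K * ‖A‖) (x := 0) (y := A) (fun y _ => hP.differentiable (by norm_num) y) (by
      intro B hB
      have hB' : ‖B‖ ≤ ‖A‖ := by simpa using hB
      have := hL.dist_le_mul B (hδS (by simpa using hB'.trans hA)) 0 (hδS (by simpa using hδ.le))
      rw [dist_eq_norm, dist_zero_right] at this
      refine this.trans (by gcongr)) (by simp) (by simp)
  rw [sub_zero, hder, hP0, show P A = 1 from hdet, sub_self, zero_sub, norm_neg] at this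
  nlinarith [norm_nonneg A, sq_nonneg ‖A‖]

lemma coeff_extract {V : Type*} [AddCommGroup V] [Module ℂ V] (W : Submodule ℂ V) (D : ℕ) (v : ℕ → V)
    (h : ∀ t : ℂ, ∑ k ∈ Finset.range D, t ^ k • v k ∈ W) : ∀ k < D, v k ∈ W := by
  intro k hk
  by_contra hv
  obtain ⟨φ, hφ, hW⟩ := Submodule.exists_le_ker_of_notMem hv
  let P : ℂ[X] := ∑ k ∈ Finset.range D, C (φ (v k)) * X ^ k
  have hP : P = 0 := by
    apply Polynomial.funext
    intro t
    have := hW (h t)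
    rw [LinearMap.mem_ker, map_sum] at this
    rw [Polynomial.eval_zero, ← this]
    simp only [P, eval_finset_sum]
    refine Finset.sum_congr rfl fun i _ => ?_
    rw [map_smul, smul_eq_mul, eval_mul, eval_C, eval_pow, eval_X, mul_comm]
  apply hφ
  have h2 : P.coeff k = φ (v k) := by
    simp only [P, finset_sum_coeff, coeff_C_mul_X_pow]
    rw [Finset.sum_ite_eq, if_pos (Finset.mem_range.2 hk)]
  rw [← h2, hP, coeff_zero]

/-- span of powers of linear forms -/
def PW (n : ℕ) : Submodule ℂ (En n → ℂ) := Submodule.span ℂ {p | ∃ (ℓ : En n →L[ℂ] ℂ) (d : ℕ), p = fun y => (ℓ y) ^ d}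

lemma PW_mul {p q : En n → ℂ} (hp : p ∈ PW n) (hq : q ∈ PW n) : p * q ∈ PW n := by
  unfold PW at hp
  induction hp using Submodule.span_induction with
  | zero => rw [zero_mul]; exact zero_mem _
  | add x y _ _ hx hy => rw [add_mul]; exact add_mem hx hy
  | smul a x _ hx => rw [smul_mul_assoc]; exact Submodule.smul_mem _ _ hx
  | mem x hx =>
    unfold PW at hq
    induction hq using Submodule.span_induction with
    | zero => rw [mul_zero]; exact zero_mem _
    | add x y _ _ hx hy => rw [mul_add]; exact add_mem hx hy
    | smul a x _ hx => rw [mul_smul_comm]; exact Submodule.smul_mem _ _ hx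
    | mem y hy =>
      obtain ⟨ℓ, a, rfl⟩ := hx
      obtain ⟨m, b, rfl⟩ := hy
      have := coeff_extract (PW n) (a + b + 1) (fun k => ((a + b).choose k : ℂ) • 
        (fun y : En n => (m y) ^ k * (ℓ y) ^ (a + b - k))) (by
          intro t
          have : ∑ k ∈ Finset.range (a + b + 1), t ^ k • (((a + b).choose k : ℂ) • 
              (fun y : En n => (m y) ^ k * (ℓ y) ^ (a + b - k))) = fun y => ((t • m + ℓ) y) ^ (a + b) := by
            ext y
            simp only [Finset.sum_apply, Pi.smul_apply, smul_eq_mul, ContinuousLinearMap.add_apply, 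
              ContinuousLinearMap.smul_apply, add_pow]
            refine Finset.sum_congr rfl fun k _ => ?_
            rw [mul_pow]; ring
          rw [this]
          exact Submodule.subset_span ⟨_, _, rfl⟩) b (by omega)
      have hc : ((a + b).choose b : ℂ) ≠ 0 := by
        exact_mod_cast (Nat.choose_pos (by omega)).ne'
      have h2 := Submodule.smul_mem _ ((a + b).choose b : ℂ)⁻¹ this
      rw [smul_smul, inv_mul_cancel₀ hc, one_smul] at h2
      convert h2 using 1
      ext y
      simp [mul_comm]

lemma PF_le_PW {p : En n → ℂ} (hp : p ∈ PF n) : p ∈ PW n := by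
  induction hp using Algebra.adjoin_induction with
  | mem x hx => 
    obtain ⟨i, rfl⟩ := hx
    exact Submodule.subset_span ⟨(EuclideanSpace.proj i : En n →L[ℂ] ℂ), 1, by ext; simp⟩
  | algebraMap r => 
    have : algebraMap ℂ (En n → ℂ) r = r • fun y => ((0 : En n →L[ℂ] ℂ) y) ^ 0 := by
      ext; simp
    rw [this]
    exact Submodule.smul_mem _ _ (Submodule.subset_span ⟨0, 0, rfl⟩)
  | add x y _ _ hx hy => exact add_mem hx hy
  | mul x y _ _ hx hy => exact PW_mul hx hy

end ChaosAux

namespace ChaosAux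
open Polynomial

variable {n : ℕ}

structure Dat (f g : En n → En n) : Prop where
  pf : PM f
  pg : PM g
  gf : ∀ y, g (f y) = y
  fg : ∀ y, f (g y) = y
  det : ∀ z, (fderiv ℂ f z).det = 1

lemma Dat.it {f g : En n → En n} (D : Dat f g) (i : ℕ) : Dat (f^[i]) (g^[i]) := by
  refine ⟨PM.iterate D.pf i, PM.iterate D.pg i, LeftInverse.iterate D.gf i, LeftInverse.iterate D.fg i, ?_⟩
  induction i with
  | zero => intro z; simp [ContinuousLinearMap.det]
  | succ k ih =>
    intro z
    rw [iterate_succ', fderiv_comp _ (D.pf.diff _) ((PM.iterate D.pf k).diff z), det_comp, ih, D.det, mul_one]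

lemma Dat.c1 {f g : En n → En n} (D : Dat f g) (x v : En n) : fderiv ℂ g (f x) (fderiv ℂ f x v) = v := by
  have h := (D.pg.diff (f x)).hasFDerivAt.comp x (D.pf.diff x).hasFDerivAt
  have e : g ∘ f = id := funext D.gf
  rw [e] at h
  have := h.unique (hasFDerivAt_id x)
  exact congrArg (fun A : En n →L[ℂ] En n => A v) this

lemma Dat.symm_c {f g : En n → En n} (D : Dat f g) (x v : En n) : fderiv ℂ f x (fderiv ℂ g (f x) v) = v := by
  have h1 : DifferentiableAt ℂ f (g (f x)) := D.pf.diff _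
  have h := h1.hasFDerivAt.comp (f x) (D.pg.diff (f x)).hasFDerivAt
  have e : f ∘ g = id := funext D.fg
  rw [e, D.gf] at h
  have := h.unique (hasFDerivAt_id (f x))
  exact congrArg (fun A : En n →L[ℂ] En n => A v) this

def TL (f g : En n → En n) (x : En n) (i : ℕ) : (En n → En n) →ₗ[ℂ] En n :=
  (fderiv ℂ (g^[i]) (f^[i] x)).toLinearMap ∘ₗ LinearMap.proj (f^[i] x)

lemma TL_apply (f g : En n → En n) (x : En n) (i : ℕ) (Y : En n → En n) :
    TL f g x i Y = fderiv ℂ (g^[i]) (f^[i] x) (Y (f^[i] x)) := rfl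

def Zs (f g : En n → En n) (x : En n) : Submodule ℂ (En n → En n) where
  carrier := {Y | Tendsto (fun m : ℕ => (m : ℂ)⁻¹ • ∑ i ∈ Finset.range m, TL f g x i Y) atTop (𝓝 0)}
  zero_mem' := by simp
  add_mem' := by
    intro a b ha hb
    have := Tendsto.add ha hb
    simpa [Finset.sum_add_distrib, smul_add] using this
  smul_mem' := by
    intro c a ha
    have := Tendsto.const_smul ha c
    rw [smul_zero] at this
    refine this.congr fun m => ?_
    simp only [map_smul, ← Finset.smul_sum]
    rw [smul_comm]

lemma Zs_iff {f g : En n → En n} {x : En n} {Y} : Y ∈ Zs f g x ↔ 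
   Tendsto (fun m : ℕ => (m : ℂ)⁻¹ • ∑ i ∈ Finset.range m, TL f g x i Y) atTop (𝓝 0) := Iff.rfl

lemma Zs_of_bdd {f g : En n → En n} {x : En n} {Y} {C : ℝ} 
    (h : ∀ m : ℕ, ‖∑ i ∈ Finset.range m, TL f g x i Y‖ ≤ C) : Y ∈ Zs f g x := by
  rw [Zs_iff]
  rw [tendsto_zero_iff_norm_tendsto_zero]
  have h1 : Tendsto (fun m : ℕ => (m : ℝ)⁻¹ * C) atTop (𝓝 0) := by
    simpa using (tendsto_inv_atTop_nhds_zero_nat (𝕜 := ℝ)).mul_const C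
  refine squeeze_zero (fun _ => norm_nonneg _) (fun m => ?_) h1
  rw [norm_smul]
  simp only [norm_inv, RCLike.norm_natCast]
  gcongr
  exact h m

/-- derivative bounds -/
lemma bnds {f g : En n → En n} (D : Dat f g) {ρ R : ℝ} (hρ : 0 < ρ) :
    ∃ C > 0, ∀ x, (∀ i : ℕ, ∀ y ∈ closedBall x ρ, ‖f^[i] y‖ ≤ R) → ∀ i, 
      ‖fderiv ℂ (f^[i]) x‖ ≤ C ∧ ‖fderiv ℂ (g^[i]) (f^[i] x)‖ ≤ C := by
  obtain ⟨C', hC', h⟩ := detinv n (R / ρ)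
  refine ⟨max C' (R/ρ), lt_max_of_lt_left hC', fun x hx i => ?_⟩
  have h1 : ‖fderiv ℂ (f^[i]) x‖ ≤ R / ρ := cauchy_fderiv (D.it i).pf.diff hρ (hx i)
  exact ⟨h1.trans (le_max_right _ _), (h _ _ ((D.it i).symm_c x) ((D.it i).det x) h1).trans (le_max_left _ _)⟩

lemma F1 {f g : En n → En n} (D : Dat f g) {x : En n} {R t0 C3 : ℝ} (ht : 0 < t0) 
    (ℓ : En n →L[ℂ] ℂ) (b : En n) (q : ℂ[X])
    (hC : ∀ i, ‖fderiv ℂ (g^[i]) (f^[i] x)‖ ≤ C3)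
    (hR : ∀ t : ℂ, ‖t‖ ≤ t0 → ∀ m : ℕ, ‖(fun y => f y + (t * q.eval (ℓ (f y))) • b)^[m] x‖ ≤ R) :
    (fun y => q.eval (ℓ y) • b) ∈ Zs f g x := by
  set Y : En n → En n := fun y => q.eval (ℓ y) • b with hY
  let c : ℕ → ℂ → En n := fun m t => (fun y => f y + (t * q.eval (ℓ (f y))) • b)^[m] x
  have hfd : Differentiable ℂ f := D.pf.diff
  have hqd : Differentiable ℂ (fun z : ℂ => q.eval z) := q.differentiable
  have c0 : ∀ t, c 0 t = x := fun t => rfl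
  have cs : ∀ m t, c (m+1) t = f (c m t) + (t * q.eval (ℓ (f (c m t)))) • b := fun m t => by
    simp only [c]; rw [iterate_succ_apply']
  have cz : ∀ m, c m 0 = f^[m] x := by
    intro m
    induction m with
    | zero => rfl
    | succ k ih => rw [cs, ih, zero_mul, zero_smul, add_zero, iterate_succ_apply']
  have cd : ∀ m, Differentiable ℂ (c m) := by
    intro m
    induction m with
    | zero => exact differentiable_const _
    | succ k ih =>
      have e : c (k+1) = fun t => f (c k t) + (t * q.eval (ℓ (f (c k t)))) • b := funext (cs k)
      rw [e]
      have h1 : Differentiable ℂ fun t => f (c k t) := hfd.comp ih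
      have h2 : Differentiable ℂ fun t => q.eval (ℓ (f (c k t))) := hqd.comp (ℓ.differentiable.comp h1)
      exact h1.add ((differentiable_id.mul h2).smul_const b)
  let S : ℕ → En n := fun m => ∑ i ∈ Finset.range m, TL f g x (i+1) Y
  have hder : ∀ m, HasDerivAt (c m) (fderiv ℂ (f^[m]) x (S m)) 0 := by
    intro m
    induction m with
    | zero => 
      have e : c 0 = fun _ => x := rfl
      rw [e]
      simpa [S] using hasDerivAt_const (0:ℂ) x
    | succ k ih =>
      have e : c (k+1) = fun t => f (c k t) + (t * q.eval (ℓ (f (c k t)))) • b := funext (cs k)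
      rw [e]
      have h1 : HasDerivAt (fun t => f (c k t)) (fderiv ℂ f (f^[k] x) (fderiv ℂ (f^[k]) x (S k))) 0 := by
        have h0 : HasFDerivAt f (fderiv ℂ f (f^[k] x)) (c k 0) := by
          rw [cz]; exact (hfd _).hasFDerivAt
        exact h0.comp_hasDerivAt 0 ih
      have h2 : DifferentiableAt ℂ (fun t => q.eval (ℓ (f (c k t)))) 0 := 
        (hqd.comp (ℓ.differentiable.comp (hfd.comp (cd k)))) 0
      refine (h1.add (((hasDerivAt_id (0:ℂ)).mul h2.hasDerivAt).smul_const b)).congr_deriv ?_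
      have h3 : fderiv ℂ (f^[k+1]) x = (fderiv ℂ f (f^[k] x)).comp (fderiv ℂ (f^[k]) x) := by
        rw [iterate_succ']
        exact fderiv_comp _ (hfd _) ((D.it k).pf.diff x)
      have h4 : fderiv ℂ (f^[k+1]) x (TL f g x (k+1) Y) = Y (f^[k+1] x) := by
        rw [TL_apply]; exact (D.it (k+1)).symm_c x _
      have h5 : S (k+1) = S k + TL f g x (k+1) Y := Finset.sum_range_succ _ _
      rw [h5, map_add, h4, h3, hY]
      simp [cz, iterate_succ_apply']
  have hDb : ∀ m, ‖fderiv ℂ (f^[m]) x (S m)‖ ≤ R / t0 := by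
    intro m
    rw [← (hder m).deriv]
    refine Complex.norm_deriv_le_of_forall_mem_sphere_norm_le ht (cd m).diffContOnCl ?_
    intro z hz
    exact hR z (by simpa using (mem_sphere_zero_iff_norm.1 hz).le) m
  have hC0 : 0 ≤ C3 := (norm_nonneg _).trans (hC 0)
  have hR0 : 0 ≤ R / t0 := (norm_nonneg _).trans (hDb 0)
  have hS : ∀ m, ‖S m‖ ≤ C3 * (R / t0) := by
    intro m
    rw [← (D.it m).c1 x (S m)]
    exact (ContinuousLinearMap.le_opNorm _ _).trans (mul_le_mul (hC m) (hDb m) (norm_nonneg _) hC0)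
  refine Zs_of_bdd (C := C3 * (R / t0) + ‖TL f g x 0 Y‖) fun m => ?_
  cases m with
  | zero => simp; positivity
  | succ k => 
    rw [Finset.sum_range_succ']
    exact (norm_add_le _ _).trans (by gcongr; exact hS k)

end ChaosAux

namespace ChaosAux
open Polynomial

variable {n : ℕ}

def curl (i j : Fin n) (p : En n → ℂ) : En n → En n := fun y =>
  (fderiv ℂ p y (EuclideanSpace.single i 1)) • EuclideanSpace.single j (1:ℂ) - 
    (fderiv ℂ p y (EuclideanSpace.single j 1)) • EuclideanSpace.single i (1:ℂ)

lemma curl_mem {Z : Submodule ℂ (En n → En n)} 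
    (hZ : ∀ (ℓ : En n →L[ℂ] ℂ) (b : En n) (q : ℂ[X]), ℓ b = 0 → (fun y => q.eval (ℓ y) • b) ∈ Z)
    (i j : Fin n) {p : En n → ℂ} (hp : p ∈ PF n) : curl i j p ∈ Z := by
  have h := PF_le_PW hp
  suffices Differentiable ℂ p ∧ curl i j p ∈ Z from this.2
  clear hp
  unfold PW at h
  induction h using Submodule.span_induction with
  | zero => 
    refine ⟨differentiable_const (0:ℂ), ?_⟩
    have : curl i j (0 : En n → ℂ) = 0 := by
      ext1 y
      have : fderiv ℂ (0 : En n → ℂ) y = 0 := fderiv_const_apply (0:ℂ)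
      simp [curl, this]
    rw [this]; exact zero_mem _
  | add x y _ _ hx hy => 
    refine ⟨hx.1.add hy.1, ?_⟩
    have : curl i j (x + y) = curl i j x + curl i j y := by
      ext1 z
      simp only [curl, Pi.add_apply, fderiv_add (hx.1 z) (hy.1 z), _root_.add_apply, add_smul]
      abel
    rw [this]; exact add_mem hx.2 hy.2
  | smul a x _ hx => 
    refine ⟨hx.1.const_smul a, ?_⟩
    have : curl i j (a • x) = a • curl i j x := by
      ext1 z
      simp only [curl, Pi.smul_apply, fderiv_const_smul (hx.1 z) a, _root_.smul_apply, smul_sub, smul_smul, smul_eq_mul]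
    rw [this]; exact Submodule.smul_mem _ _ hx.2
  | mem x hx =>
    obtain ⟨ℓ, d, rfl⟩ := hx
    refine ⟨ℓ.differentiable.pow d, ?_⟩
    have := hZ ℓ (ℓ (EuclideanSpace.single i 1) • EuclideanSpace.single j (1:ℂ) - 
      ℓ (EuclideanSpace.single j 1) • EuclideanSpace.single i (1:ℂ)) (C (d:ℂ) * X ^ (d-1)) (by
        simp [mul_comm])
    convert this using 1
    ext1 y
    have hd : HasFDerivAt (fun y => ℓ y ^ d) ((d * ℓ y ^ (d-1)) • ℓ) y := 
      (hasDerivAt_pow d (ℓ y)).comp_hasFDerivAt y ℓ.hasFDerivAt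
    simp only [curl, hd.fderiv, _root_.smul_apply, smul_sub, smul_smul, smul_eq_mul]
    simp

lemma sum_coord (A : En n →L[ℂ] En n) (y : En n) (l : Fin n) : 
    ∑ i, y i * (A (EuclideanSpace.single i 1)) l = (A y) l := by
  conv_rhs => rw [← (EuclideanSpace.basisFun (Fin n) ℂ).sum_repr y]
  simp

lemma curl_sum {u : En n → En n} (hu : PM u) (y : En n) : 
    ∑ i, ∑ j, curl i j (fun y => y i * u y j) y = ((n : ℂ) - 1) • u y + fderiv ℂ u y y - tr (fderiv ℂ u y) • y := by
  have hd : ∀ i j v, fderiv ℂ (fun y : En n => y i * u y j) y v = y i * (fderiv ℂ u y v) j + u y j * v i := by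
    intro i j v
    have h1 : HasFDerivAt (fun y : En n => y i) (EuclideanSpace.proj i : En n →L[ℂ] ℂ) y := 
      (EuclideanSpace.proj i : En n →L[ℂ] ℂ).hasFDerivAt
    have h2 : HasFDerivAt (fun y : En n => u y j) ((EuclideanSpace.proj j : En n →L[ℂ] ℂ).comp (fderiv ℂ u y)) y := 
      (EuclideanSpace.proj j : En n →L[ℂ] ℂ).hasFDerivAt.comp y (hu.diff y).hasFDerivAt
    have h3 : HasFDerivAt (fun y : En n => y i * u y j) _ y := h1.mul h2
    rw [h3.fderiv]
    simp
  ext l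
  simp only [curl, hd, tr]
  simp [Finset.sum_sub_distrib, Finset.sum_add_distrib, add_mul, Pi.single_apply, 
    ← sum_coord (fderiv ℂ u y) y l, Finset.sum_mul, Finset.mul_sum]
  simp [mul_comm]
  ring

lemma avg_le {a : ℕ → En n} {w : En n} {ε : ℝ} 
    (h : Tendsto (fun m : ℕ => (m : ℂ)⁻¹ • ∑ i ∈ Finset.range m, a i) atTop (𝓝 0))
    (hw : ∀ i, ‖a i - w‖ ≤ ε) : ‖w‖ ≤ ε := by
  have h1 : Tendsto (fun m : ℕ => ‖(m : ℂ)⁻¹ • ∑ i ∈ Finset.range m, a i - w‖) atTop (𝓝 ‖0 - w‖) := 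
    (h.sub_const w).norm
  rw [zero_sub, norm_neg] at h1
  refine le_of_tendsto h1 ?_
  filter_upwards [eventually_gt_atTop 0] with m hm
  have hm' : (m : ℂ) ≠ 0 := by exact_mod_cast hm.ne'
  have hm2 : (m : ℝ) ≠ 0 := by exact_mod_cast hm.ne'
  have e : (m : ℂ)⁻¹ • ∑ i ∈ Finset.range m, a i - w = (m : ℂ)⁻¹ • ∑ i ∈ Finset.range m, (a i - w) := by
    rw [Finset.sum_sub_distrib, smul_sub]
    congr 1
    simp only [Finset.sum_const, Finset.card_range]
    rw [← Nat.cast_smul_eq_nsmul ℂ, smul_smul, inv_mul_cancel₀ hm', one_smul]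
  rw [e, norm_smul]
  have := norm_sum_le_of_le (Finset.range m) (fun i _ => hw i)
  simp only [Finset.sum_const, Finset.card_range, nsmul_eq_mul] at this
  simp only [norm_inv, RCLike.norm_natCast]
  calc (m:ℝ)⁻¹ * _ ≤ (m:ℝ)⁻¹ * (m * ε) := by gcongr
    _ = ε := by field_simp

lemma W_mem {f g : En n → En n} (D : Dat f g) {x : En n} {R C : ℝ} (hR : ∀ i : ℕ, ‖f^[i] x‖ ≤ R)
    (hC : ∀ i, ‖fderiv ℂ (g^[i]) (f^[i] x)‖ ≤ C) (k : ℕ) : 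
    (fun y => fderiv ℂ (g^[k]) (f^[k] y) (f^[k] y) - y) ∈ Zs f g x := by
  set W : En n → En n := (fun y => fderiv ℂ (g^[k]) (f^[k] y) (f^[k] y) - y)
  let a : ℕ → En n := fun i => TL f g x i id
  have hC0 : 0 ≤ C := (norm_nonneg _).trans (hC 0)
  have ha : ∀ i, ‖a i‖ ≤ C * R := fun i => 
    (ContinuousLinearMap.le_opNorm _ _).trans (mul_le_mul (hC i) (hR i) (norm_nonneg _) hC0)
  have hT : ∀ i, TL f g x i W = a (k + i) - a i := by
    intro i
    simp only [a, TL_apply, W, map_sub, id]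
    congr 1
    have e1 : f^[k] (f^[i] x) = f^[k+i] x := (iterate_add_apply f k i x).symm
    have e2 : g^[k+i] = g^[i] ∘ g^[k] := by rw [add_comm, iterate_add]
    have e3 : g^[k] (f^[k+i] x) = f^[i] x := by rw [← e1]; exact (D.it k).gf _
    rw [e1, e2, fderiv_comp _ ((D.it i).pg.diff _) ((D.it k).pg.diff _), e3]
    rfl
  refine Zs_of_bdd (C := k * (2 * (C * R))) fun m => ?_
  have e : ∑ i ∈ Finset.range m, TL f g x i W = ∑ i ∈ Finset.range k, (a (m + i) - a i) := by
    rw [Finset.sum_congr rfl fun i _ => hT i, Finset.sum_sub_distrib, Finset.sum_sub_distrib]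
    have h1 := Finset.sum_range_add a k m
    have h2 := Finset.sum_range_add a m k
    rw [add_comm m k, h1] at h2
    rw [sub_eq_sub_iff_add_eq_add, add_comm, h2, add_comm]
  rw [e]
  have := norm_sum_le_of_le (Finset.range k) (f := fun i => a (m + i) - a i) (n := fun _ => 2 * (C * R)) (fun i _ => 
    (norm_sub_le _ _).trans (by linarith [ha (m+i), ha i]))
  simpa using this

lemma alg_id (A B : En n →L[ℂ] En n) (hBA : ∀ v, B (v + A v) = v) (u y : En n) (c t : ℂ) : 
    ((c - 1) • u + A y - t • y) + (B (y + u) - y) - c • u = - B (A (u - A y)) - t • y := by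
  have h1 := hBA (A y)
  have h2 := hBA (y + u)
  have h3 : B (A (u - A y)) = - B (y + u) + y + u - A y := by
    rw [map_sub, map_sub]
    simp only [map_add] at h1 h2 ⊢
    have : B (A u) = y + u - B y - B u - B (A y) := by
      rw [eq_sub_iff_add_eq, eq_sub_iff_add_eq, eq_sub_iff_add_eq]; rw [← h2]; 
      abel
    have h5 : B (A (A y)) = A y - B (A y) := by rw [eq_sub_iff_add_eq, add_comm]; exact h1
    rw [this, h5]; abel
  rw [h3, sub_smul, one_smul]
  abel

end ChaosAux

namespace ChaosAux
open Polynomial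

variable {n : ℕ}

lemma op_le {A : En n →L[ℂ] En n} {v : En n} {a b : ℝ} (hA : ‖A‖ ≤ a) (hv : ‖v‖ ≤ b) : ‖A v‖ ≤ a * b :=
  (ContinuousLinearMap.le_opNorm _ _).trans (mul_le_mul hA hv (norm_nonneg _) ((norm_nonneg _).trans hA))

lemma F5 {f g : En n → En n} (D : Dat f g) {x0 : En n} {ρ R : ℝ} (hρ : 0 < ρ)
    (hb : ∀ i : ℕ, ∀ y ∈ closedBall x0 (3 * ρ), ‖f^[i] y‖ ≤ R)
    (hZ : ∀ x ∈ closedBall x0 ρ, ∀ (ℓ : En n →L[ℂ] ℂ) (b : En n) (q : ℂ[X]), ℓ b = 0 → 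
      (fun y => q.eval (ℓ y) • b) ∈ Zs f g x) :
    ∃ K > 0, ∃ σ > 0, ∀ k : ℕ, ∀ x ∈ closedBall x0 ρ, f^[k] x ∈ closedBall x0 ρ → ∀ s : ℝ,
      ‖f^[k] x - x‖ ≤ s → ‖fderiv ℂ (f^[k]) x - 1‖ ≤ s → s ≤ σ → n * ‖f^[k] x - x‖ ≤ K * s ^ 2 := by
  obtain ⟨C, hC0, hC⟩ := bnds (R := R) D hρ
  obtain ⟨Kt, hKt, δ, hδ, htr⟩ := trace_bound n
  have hR0 : 0 ≤ R := (norm_nonneg _).trans (hb 0 x0 (mem_closedBall_self (by positivity)))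
  have hC' : ∀ x ∈ closedBall x0 ρ, ∀ i, ‖fderiv ℂ (f^[i]) x‖ ≤ C ∧ ‖fderiv ℂ (g^[i]) (f^[i] x)‖ ≤ C := by
    intro x hx
    refine hC x fun i y hy => hb i y ?_
    rw [mem_closedBall] at *
    linarith [dist_triangle y x x0]
  set L := R / ρ ^ 2 with hL
  have hL0 : 0 ≤ L := by positivity
  set C4 := C * (L + C) with hC4
  have hC40 : 0 < C4 := by positivity
  refine ⟨C * (2 * C4 * (C + L + C4 * R) + Kt * C4 ^ 2 * R) + n * (C * L) + 1, by positivity, 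
    min 1 (min (1/(2*C4)) (δ/C4)), by positivity, fun k x hx hφx s hs1 hs2 hsσ => ?_⟩
  have hs0 : 0 ≤ s := (norm_nonneg _).trans hs1
  have hσ1 : s ≤ 1 := hsσ.trans (min_le_left _ _)
  have hσ2 : C4 * s ≤ 1/2 := by
    have : s ≤ 1/(2*C4) := hsσ.trans ((min_le_right _ _).trans (min_le_left _ _))
    rw [le_div_iff₀ (by positivity)] at this
    linarith
  have hσ3 : C4 * s ≤ δ := by
    have : s ≤ δ/C4 := hsσ.trans ((min_le_right _ _).trans (min_le_right _ _))
    rw [le_div_iff₀ (by positivity)] at this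
    linarith
  set u : En n → En n := fun y => f^[k] y - y with hu
  have huPM : PM u := by
    intro i
    have : (fun y => u y i) = (fun y => f^[k] y i) - (fun y : En n => y i) := by ext y; simp [hu]
    rw [this]
    exact sub_mem ((D.it k).pf i) (coord_mem i)
  have hDu : ∀ y, fderiv ℂ u y = fderiv ℂ (f^[k]) y - 1 := by
    intro y
    exact (((D.it k).pf.diff y).hasFDerivAt.sub (hasFDerivAt_id y)).fderiv
  let V : En n → En n := fun y => (((n : ℂ) - 1) • u y + fderiv ℂ u y y - tr (fderiv ℂ u y) • y) + 
    (fderiv ℂ (g^[k]) (f^[k] y) (f^[k] y) - y)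
  have hVZ : V ∈ Zs f g x := by
    refine add_mem (a := fun y => (((n : ℂ) - 1) • u y + fderiv ℂ u y y - tr (fderiv ℂ u y) • y)) ?_ 
      (W_mem D (R := R) (C := C) (fun i => hb i x (closedBall_subset_closedBall (by linarith) hx)) (fun i => (hC' x hx i).2) k)
    have e : (fun y => (((n : ℂ) - 1) • u y + fderiv ℂ u y y - tr (fderiv ℂ u y) • y)) = 
        ∑ i, ∑ j, curl i j (fun y => y i * u y j) := by
      ext1 y
      rw [← curl_sum huPM y]
      simp [Finset.sum_apply]
    rw [e]
    exact sum_mem fun i _ => sum_mem fun j _ => curl_mem (hZ x hx) i j (mul_mem (coord_mem i) (huPM j))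
  have hcomm : ∀ i y, f^[k] (f^[i] y) = f^[i] (f^[k] y) := fun i y => by
    rw [← iterate_add_apply, ← iterate_add_apply, add_comm]
  -- u along the orbit
  have htay : ∀ i, ‖u (f^[i] x) - fderiv ℂ (f^[i]) x (u x)‖ ≤ L * s ^ 2 := by
    intro i
    have := taylor (D.it i).pf.diff hρ (hb i) hx hφx
    simp only [hu, hcomm]
    exact this.trans (by gcongr)
  have hui : ∀ i, ‖u (f^[i] x)‖ ≤ (C + L) * s := by
    intro i
    have h1 := htay i
    have h2 : ‖fderiv ℂ (f^[i]) x (u x)‖ ≤ C * s := op_le (hC' x hx i).1 hs1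
    have h3 := norm_sub_norm_le (u (f^[i] x)) (fderiv ℂ (f^[i]) x (u x))
    have h4 : L * s ^ 2 ≤ L * s := by
      have : s ^ 2 ≤ s := by nlinarith
      gcongr
    linarith
  have hAi : ∀ i, ‖fderiv ℂ u (f^[i] x)‖ ≤ C4 * s := by
    intro i
    have h1 : ∀ v, fderiv ℂ (f^[k]) (f^[i] x) (fderiv ℂ (f^[i]) x v) = fderiv ℂ (f^[i]) (f^[k] x) (fderiv ℂ (f^[k]) x v) := by
      intro v
      have ha := fderiv_comp x ((D.it k).pf.diff (f^[i] x)) ((D.it i).pf.diff x)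
      have hb := fderiv_comp x ((D.it i).pf.diff (f^[k] x)) ((D.it k).pf.diff x)
      rw [show f^[k] ∘ f^[i] = f^[i] ∘ f^[k] from funext (hcomm i), hb] at ha
      exact congrArg (fun A : En n →L[ℂ] En n => A v) ha.symm
    refine ContinuousLinearMap.opNorm_le_bound _ (by positivity) fun w => ?_
    set v := fderiv ℂ (g^[i]) (f^[i] x) w with hv
    have hw : w = fderiv ℂ (f^[i]) x v := ((D.it i).symm_c x w).symm
    have hvn : ‖v‖ ≤ C * ‖w‖ := op_le (hC' x hx i).2 le_rfl
    have e : fderiv ℂ u (f^[i] x) w = (fderiv ℂ (f^[i]) (f^[k] x) - fderiv ℂ (f^[i]) x) v + 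
        fderiv ℂ (f^[i]) (f^[k] x) ((fderiv ℂ (f^[k]) x - 1) v) := by
      rw [hDu]
      conv_lhs => rw [hw]
      simp only [_root_.sub_apply, h1, map_sub]
      simp
    rw [e]
    have h2 : ‖fderiv ℂ (f^[i]) (f^[k] x) - fderiv ℂ (f^[i]) x‖ ≤ L * s := 
      (fderiv_lip (D.it i).pf.diff hρ (hb i) hx hφx).trans (by gcongr)
    calc _ ≤ L * s * (C * ‖w‖) + C * (s * (C * ‖w‖)) := 
        (norm_add_le _ _).trans (add_le_add (op_le h2 hvn) (op_le (hC' _ hφx i).1 (op_le hs2 hvn)))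
      _ = C4 * s * ‖w‖ := by rw [hC4]; ring
  have hVu : ∀ i, ‖V (f^[i] x) - (n:ℂ) • u (f^[i] x)‖ ≤ (2 * C4 * (C + L + C4 * R) + Kt * C4 ^ 2 * R) * s ^ 2 := by
    intro i
    set y := f^[i] x with hy
    set A := fderiv ℂ u y with hA
    set B := fderiv ℂ (g^[k]) (f^[k] y) with hB
    have hyR : ‖y‖ ≤ R := hb i x (closedBall_subset_closedBall (by linarith) hx)
    have hBA : ∀ v, B (v + A v) = v := by
      intro v
      have := (D.it k).c1 y v
      rw [hA, hDu]
      simpa using this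
    have hBn : ‖B‖ ≤ 2 := by
      have h1 : B = 1 - B.comp A := by
        ext1 v
        have := hBA v
        rw [map_add] at this
        exact eq_sub_of_add_eq this
      have h2 : ‖B‖ ≤ 1 + ‖B‖ * (1/2) := by
        conv_lhs => rw [h1]
        refine (norm_sub_le _ _).trans (add_le_add ContinuousLinearMap.norm_id_le ?_)
        exact (ContinuousLinearMap.opNorm_comp_le _ _).trans (by gcongr; exact (hAi i).trans hσ2)
      linarith
    have e : V y - (n:ℂ) • u y = - B (A (u y - A y)) - tr A • y := by
      rw [← alg_id A B hBA (u y) y n (tr A)]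
      simp only [V]
      rw [show y + u y = f^[k] y by simp [hu]]
    rw [e]
    have h1 : ‖tr A‖ ≤ Kt * (C4 * s) ^ 2 := by
      refine (htr A ((hAi i).trans hσ3) ?_).trans ?_
      · rw [hA, hDu, add_sub_cancel]; exact (D.it k).det y
      · gcongr; exact hAi i
    have h2 : ‖u y - A y‖ ≤ (C + L) * s + C4 * s * R := (norm_sub_le _ _).trans (add_le_add (hui i) (op_le (hAi i) hyR))
    calc _ ≤ 2 * (C4 * s * ((C + L) * s + C4 * s * R)) + Kt * (C4 * s) ^ 2 * R := by
          refine (norm_sub_le _ _).trans (add_le_add ?_ ?_)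
          · rw [norm_neg]; exact op_le hBn (op_le (hAi i) h2)
          · rw [norm_smul]; gcongr
      _ = _ := by ring
  have hfin : ‖(n:ℂ) • u x‖ ≤ (C * (2 * C4 * (C + L + C4 * R) + Kt * C4 ^ 2 * R) + n * (C * L)) * s ^ 2 := by
    refine avg_le (Zs_iff.1 hVZ) fun i => ?_
    have e : TL f g x i V - (n:ℂ) • u x = fderiv ℂ (g^[i]) (f^[i] x) (V (f^[i] x) - (n:ℂ) • u (f^[i] x)) + 
        (n:ℂ) • fderiv ℂ (g^[i]) (f^[i] x) (u (f^[i] x) - fderiv ℂ (f^[i]) x (u x)) := by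
      rw [TL_apply, map_sub, map_sub, (D.it i).c1, map_smul, smul_sub]
      module
    rw [e]
    refine (norm_add_le _ _).trans ?_
    rw [norm_smul]
    have h1 := op_le (hC' x hx i).2 (hVu i)
    have h2 := op_le (hC' x hx i).2 (htay i)
    have h3 := mul_le_mul_of_nonneg_left h2 (norm_nonneg (n:ℂ))
    simp only [RCLike.norm_natCast] at h3 ⊢
    linarith
  rw [norm_smul] at hfin
  simp only [RCLike.norm_natCast] at hfin
  refine hfin.trans ?_
  nlinarith [sq_nonneg s]

end ChaosAux

namespace ChaosAux
open Polynomial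

variable {n : ℕ}

lemma F7 (hn : 2 ≤ n) {f g : En n → En n} (D : Dat f g) {x0 : En n} {ρ K σ η : ℝ} (hρ : 0 < ρ) (hK : 0 < K) (hη : 0 < η)
    {k : ℕ} (h5 : ∀ x ∈ closedBall x0 ρ, f^[k] x ∈ closedBall x0 ρ → ∀ s : ℝ,
      ‖f^[k] x - x‖ ≤ s → ‖fderiv ℂ (f^[k]) x - 1‖ ≤ s → s ≤ σ → n * ‖f^[k] x - x‖ ≤ K * s ^ 2)
    (h1 : η ≤ ρ / 2) (h2 : (1 + 8 / ρ) * η ≤ σ) (h3 : 16 * K * (1 + 8 / ρ) ^ 2 * η ≤ 1) 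
    (hx : ∀ x ∈ closedBall x0 (ρ / 2), ‖f^[k] x - x‖ ≤ η) : 
    ∀ x ∈ closedBall x0 (ρ / 4), f^[k] x = x := by
  set c := 1 + 8 / ρ with hc
  have hc0 : 0 < c := by positivity
  set u : En n → En n := fun y => f^[k] y - y with hu
  have hdu : Differentiable ℂ u := (D.it k).pf.diff.sub differentiable_id
  have hDu : ∀ y, fderiv ℂ u y = fderiv ℂ (f^[k]) y - 1 := by
    intro y
    exact (((D.it k).pf.diff y).hasFDerivAt.sub (hasFDerivAt_id y)).fderiv
  have key : ∀ j : ℕ, ∀ x ∈ closedBall x0 (ρ / 4 * (1 + (1/2:ℝ) ^ j)), ‖u x‖ ≤ η * ((1/2:ℝ) ^ j) ^ 4 := by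
    intro j
    induction j with
    | zero => 
      intro x hxx
      simp only [pow_zero, one_pow, mul_one] at hxx ⊢
      exact hx x (by convert hxx using 2; ring)
    | succ j ih =>
      intro x hxx
      rw [pow_succ (1/2:ℝ) j] at hxx ⊢
      set t := (1/2:ℝ) ^ j with ht
      have ht0 : 0 < t := by positivity
      have ht1 : t ≤ 1 := pow_le_one₀ (by norm_num) (by norm_num)
      rw [mem_closedBall] at hxx
      have hD : ‖fderiv ℂ u x‖ ≤ η * t ^ 4 / (ρ / 8 * t) := by
        refine cauchy_fderiv hdu (by positivity) fun y hy => ih y ?_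
        rw [mem_closedBall] at *
        have := dist_triangle y x x0
        nlinarith
      have hD' : η * t ^ 4 / (ρ / 8 * t) = 8 / ρ * η * t ^ 3 := by field_simp
      have hux : ‖u x‖ ≤ η * t ^ 4 := ih x (by rw [mem_closedBall]; nlinarith)
      have ht4 : t ^ 4 ≤ t ^ 3 := pow_le_pow_of_le_one ht0.le ht1 (by norm_num)
      have ht3 : t ^ 3 ≤ 1 := pow_le_one₀ ht0.le ht1
      have ht41 : t ^ 4 ≤ 1 := pow_le_one₀ ht0.le ht1
      have hs1 : ‖u x‖ ≤ c * η * t ^ 3 := by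
        have : 0 ≤ 8 / ρ * η * t ^ 3 := by positivity
        have h : η * t ^ 4 ≤ η * t ^ 3 := by gcongr
        rw [hc]; nlinarith
      have hs2 : ‖fderiv ℂ (f^[k]) x - 1‖ ≤ c * η * t ^ 3 := by
        rw [← hDu]
        have : 0 ≤ η * t ^ 3 := by positivity
        rw [hc]; rw [hD'] at hD; nlinarith
      have hxρ : dist x x0 ≤ ρ / 2 := by nlinarith
      have hfx : f^[k] x ∈ closedBall x0 ρ := by
        rw [mem_closedBall]
        have h : dist (f^[k] x) x ≤ η := by
          rw [dist_eq_norm]; exact hx x hxρ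
        linarith [dist_triangle (f^[k] x) x x0]
      have := h5 x (by rw [mem_closedBall]; linarith) hfx (c * η * t ^ 3) hs1 hs2 (by
        refine le_trans ?_ h2
        have : 0 ≤ c * η := by positivity
        nlinarith)
      have hn' : (2:ℝ) ≤ n := by exact_mod_cast hn
      have h6 : K * (c * η * t ^ 3) ^ 2 ≤ η * t ^ 4 / 16 := by
        have e : K * (c * η * t ^ 3) ^ 2 = (16 * K * c ^ 2 * η) * (η * t ^ 4 / 16) * t ^ 2 := by ring
        rw [e]
        have ht2 : t ^ 2 ≤ 1 := pow_le_one₀ ht0.le ht1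
        calc _ ≤ 1 * (η * t ^ 4 / 16) * 1 := by gcongr
          _ = _ := by ring
      have h7 : (t * (1/2)) ^ 4 = t ^ 4 / 16 := by ring
      rw [h7]
      have : ‖u x‖ ≤ n * ‖u x‖ := by nlinarith [norm_nonneg (u x)]
      linarith
  intro x hxx
  have hlim : Tendsto (fun j : ℕ => η * ((1/2:ℝ) ^ j) ^ 4) atTop (𝓝 (η * 0 ^ 4)) := 
    ((tendsto_pow_atTop_nhds_zero_of_lt_one (by norm_num) (by norm_num)).pow 4).const_mul η
  have h0 : ‖u x‖ ≤ η * 0 ^ 4 := ge_of_tendsto' hlim fun j => key j x (by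
    refine closedBall_subset_closedBall ?_ hxx
    have : (0:ℝ) < (1/2) ^ j := by positivity
    nlinarith)
  have h00 : ‖u x‖ = 0 := le_antisymm (by simpa using h0) (norm_nonneg _)
  exact sub_eq_zero.1 (norm_eq_zero.1 h00)

lemma F6 {f g : En n → En n} (D : Dat f g) {x0 : En n} {ρ R : ℝ} (hρ : 0 < ρ)
    (hb : ∀ i : ℕ, ∀ y ∈ closedBall x0 (3 * ρ), ‖f^[i] y‖ ≤ R) {η0 : ℝ} (hη0 : 0 < η0) :
    ∃ k : ℕ, 0 < k ∧ ∀ x ∈ closedBall x0 (ρ / 2), ‖f^[k] x - x‖ ≤ η0 := by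
  obtain ⟨C, hC0, hC⟩ := bnds (R := R) D hρ
  have hR0 : 0 ≤ R := (norm_nonneg _).trans (hb 0 x0 (mem_closedBall_self (by positivity)))
  have hC' : ∀ x ∈ closedBall x0 ρ, ∀ i, ‖fderiv ℂ (f^[i]) x‖ ≤ C ∧ ‖fderiv ℂ (g^[i]) (f^[i] x)‖ ≤ C := by
    intro x hx
    refine hC x fun i y hy => hb i y ?_
    rw [mem_closedBall] at *
    linarith [dist_triangle y x x0]
  set L := R / ρ ^ 2 with hL
  have hL0 : 0 ≤ L := by positivity
  obtain ⟨η, hη, hηη, hηρ, hηL⟩ : ∃ η > 0, η ≤ η0 ∧ η ≤ ρ / 2 ∧ L * η ≤ 1 / (2 * C) := by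
    refine ⟨min η0 (min (ρ/2) (1 / (2 * C) / (L + 1))), by positivity, min_le_left _ _, 
      (min_le_right _ _).trans (min_le_left _ _), ?_⟩
    have : min η0 (min (ρ/2) (1 / (2 * C) / (L + 1))) ≤ 1 / (2 * C) / (L + 1) := 
      (min_le_right _ _).trans (min_le_right _ _)
    calc _ ≤ (L + 1) * (1 / (2 * C) / (L + 1)) := by gcongr; linarith
      _ = _ := by field_simp
  set ε := η / (2 * C) / (2 * C + 1) with hε
  have hε0 : 0 < ε := by positivity
  have hlip : ∀ i, ∀ a ∈ closedBall x0 ρ, ∀ b ∈ closedBall x0 ρ, ‖f^[i] b - f^[i] a‖ ≤ C * ‖b - a‖ := by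
    intro i a ha b hb
    exact (convex_closedBall x0 ρ).norm_image_sub_le_of_norm_fderiv_le (𝕜 := ℂ) (fun y _ => (D.it i).pf.diff y)
      (fun y hy => (hC' y hy i).1) ha hb
  obtain ⟨t, htsub, htfin, htcov⟩ := (isCompact_closedBall x0 (ρ/2)).finite_cover_balls hε0
  have : Fintype t := htfin.fintype
  let a : ℕ → (t → En n) := fun i y => f^[i] y
  have hsub : closedBall x0 (ρ/2) ⊆ closedBall x0 ρ := closedBall_subset_closedBall (by linarith)
  have hsub3 : closedBall x0 (ρ/2) ⊆ closedBall x0 (3*ρ) := closedBall_subset_closedBall (by linarith)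
  obtain ⟨l, -, φ, hφ, hlim⟩ := tendsto_subseq_of_bounded (s := closedBall (0 : t → En n) R) isBounded_closedBall (x := a) (by
    intro i
    rw [mem_closedBall_zero_iff, pi_norm_le_iff_of_nonneg hR0]
    exact fun y => hb i y (hsub3 (htsub y.2)))
  obtain ⟨N, hN⟩ := Metric.cauchySeq_iff.1 hlim.cauchySeq ε hε0
  have hNN := hN (N+1) (by omega) N le_rfl
  have hlt : φ N < φ (N+1) := hφ (by omega)
  refine ⟨φ (N+1) - φ N, by omega, fun x hx => ?_⟩
  set i := φ N
  set j := φ (N+1)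
  obtain ⟨y, hyt, hxy⟩ := mem_iUnion₂.1 (htcov hx)
  rw [mem_ball, dist_eq_norm] at hxy
  have hxρ := hsub hx
  have hyρ := hsub (htsub hyt)
  have h1 : ‖f^[j] y - f^[i] y‖ ≤ ε := by
    have := (dist_le_pi_dist _ _ (⟨y, hyt⟩ : t)).trans hNN.le
    rwa [dist_eq_norm] at this
  have h2 := hlip j y hyρ x hxρ
  have h3 := hlip i x hxρ y hyρ
  rw [norm_sub_rev y x] at h3
  have h4 : ‖f^[j] x - f^[i] x‖ ≤ η / (2 * C) := by
    have e : f^[j] x - f^[i] x = (f^[j] x - f^[j] y) + (f^[j] y - f^[i] y) + (f^[i] y - f^[i] x) := by abel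
    have h5 := norm_add₃_le (a := (f^[j] x - f^[j] y)) (b := (f^[j] y - f^[i] y)) (c := (f^[i] y - f^[i] x))
    rw [← e] at h5
    have h6 : C * ‖x - y‖ ≤ C * ε := by gcongr
    have h7 : (2 * C + 1) * ε = η / (2 * C) := by rw [hε]; field_simp
    linarith
  obtain ⟨x', hx', hfx'⟩ := quant_inv (D.it i).pf.diff hη.le hC0 ((D.it i).symm_c x) (hC' x hxρ i).2 (p := x) (by
    intro z hz
    have hzρ : z ∈ closedBall x0 ρ := by
      rw [mem_closedBall] at *
      linarith [dist_triangle z x x0]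
    refine (fderiv_lip (D.it i).pf.diff hρ (hb i) hxρ hzρ).trans (le_trans ?_ hηL)
    rw [mem_closedBall, dist_eq_norm] at hz
    gcongr) h4
  have h8 : f^[j] x = f^[i] (f^[j - i] x) := by
    rw [← iterate_add_apply]; congr 2; omega
  rw [h8] at hfx'
  have h9 : x' = f^[j-i] x := (LeftInverse.injective (D.it i).gf) hfx'
  rw [← h9]
  rw [mem_closedBall, dist_eq_norm] at hx'
  linarith

end ChaosAux

namespace ChaosAux
open Polynomial

variable {n : ℕ}

lemma F8 (hn : 2 ≤ n) {f g : En n → En n} (D : Dat f g) {U : Set (En n)} 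
    (hZ : ∀ x ∈ U, ∀ (ℓ : En n →L[ℂ] ℂ) (b : En n) (q : ℂ[X]), ℓ b = 0 → 
      (fun y => q.eval (ℓ y) • b) ∈ Zs f g x)
    (hk : ∃ k : ℕ, 0 < k ∧ ∃ U' ⊆ U, IsOpen U' ∧ U'.Nonempty ∧ ∀ x ∈ U', f^[k] x = x) : False := by
  classical
  obtain ⟨hk0, U', hU'U, hU'o, hU'ne, hper⟩ := Nat.find_spec hk
  have hmin := fun m hm => Nat.find_min hk (m := m) hm
  set k := Nat.find hk
  have hfree : ∀ j : ℕ, ∃ V ⊆ U', IsOpen V ∧ V.Nonempty ∧ ∀ i, 0 < i → i < j → i < k → ∀ x ∈ V, f^[i] x ≠ x := by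
    intro j
    induction j with
    | zero => exact ⟨U', subset_rfl, hU'o, hU'ne, fun i _ h => absurd h (by omega)⟩
    | succ j ih =>
      obtain ⟨V, hV, hVo, hVne, hVf⟩ := ih
      by_cases hj : 0 < j ∧ j < k
      · have : ∃ x ∈ V, f^[j] x ≠ x := by
          by_contra! hcon
          exact hmin j hj.2 ⟨hj.1, V, hV.trans hU'U, hVo, hVne, hcon⟩
        obtain ⟨x, hxV, hx⟩ := this
        refine ⟨V ∩ {x | f^[j] x ≠ x}, inter_subset_left.trans hV, hVo.inter ?_, ⟨x, hxV, hx⟩, ?_⟩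
        · exact isOpen_ne_fun (D.it j).pf.diff.continuous continuous_id
        · intro i hi hij hik y hy
          rcases Nat.lt_succ_iff_lt_or_eq.1 hij with h | h
          · exact hVf i hi h hik y hy.1
          · rw [h]; exact hy.2
      · refine ⟨V, hV, hVo, hVne, fun i hi hij hik => hVf i hi ?_ hik⟩
        rcases Nat.lt_succ_iff_lt_or_eq.1 hij with h | h
        · exact h
        · exact absurd ⟨h ▸ hi, h ▸ hik⟩ hj
  obtain ⟨V, hV, hVo, ⟨x, hxV⟩, hVf⟩ := hfree k
  have hxU' := hV hxV
  obtain ⟨ℓ', hℓ'⟩ := Module.exists_dual_forall_apply_ne_zero (K := ℂ) (M := En n)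
    (fun i : Finset.Ioo 0 k => x - f^[(i:ℕ)] x) (by
      rintro ⟨i, hi⟩
      rw [Finset.mem_Ioo] at hi
      exact sub_ne_zero.2 (hVf i hi.1 hi.2 hi.2 x hxV).symm)
  let ℓ : En n →L[ℂ] ℂ := LinearMap.toContinuousLinearMap ℓ'
  have hℓ : ∀ i, 0 < i → i < k → ℓ x - ℓ (f^[i] x) ≠ 0 := by
    intro i h1 h2
    have := hℓ' ⟨i, Finset.mem_Ioo.2 ⟨h1, h2⟩⟩
    rw [← map_sub]; exact this
  obtain ⟨b, hb0, hb⟩ := exists_ker hn ℓ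
  let q : ℂ[X] := ∏ i ∈ Finset.Ioo 0 k, (X - C (ℓ (f^[i] x)))
  have hq : ∀ z, q.eval z = ∏ i ∈ Finset.Ioo 0 k, (z - ℓ (f^[i] x)) := by
    intro z; simp [q, eval_prod]
  have hq1 : q.eval (ℓ x) ≠ 0 := by
    rw [hq, Finset.prod_ne_zero_iff]
    intro i hi
    rw [Finset.mem_Ioo] at hi
    exact hℓ i hi.1 hi.2
  have hq0 : ∀ i, 0 < i → i < k → q.eval (ℓ (f^[i] x)) = 0 := by
    intro i h1 h2
    rw [hq]
    exact Finset.prod_eq_zero (Finset.mem_Ioo.2 ⟨h1, h2⟩) (sub_self _)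
  have hY := Zs_iff.1 (hZ x (hU'U hxU') ℓ b q hb)
  set Y : En n → En n := fun y => q.eval (ℓ y) • b with hYd
  have hperm : ∀ m : ℕ, ∀ y ∈ U', f^[k * m] y = y := by
    intro m y hy
    rw [iterate_mul]
    exact iterate_fixed (hper y hy) m
  have hT0 : ∀ m, TL f g x (k * m) Y = Y x := by
    intro m
    rw [TL_apply]
    have h1 : fderiv ℂ (f^[k*m]) x = ContinuousLinearMap.id ℂ _ := by
      have : f^[k*m] =ᶠ[𝓝 x] id := by
        filter_upwards [hU'o.mem_nhds hxU'] with y hy using hperm m y hy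
      rw [this.fderiv_eq, fderiv_id]
    have h2 := (D.it (k*m)).c1 x (Y x)
    rw [h1] at h2
    rw [show Y (f^[k*m] x) = Y x by rw [hperm m x hxU']]
    exact h2
  have hT1 : ∀ m i, 0 < i → i < k → TL f g x (k * m + i) Y = 0 := by
    intro m i h1 h2
    have : f^[k*m+i] x = f^[i] x := by
      rw [add_comm, iterate_add_apply, hperm m x hxU']
    rw [TL_apply, this]
    have : Y (f^[i] x) = 0 := by simp [hYd, hq0 i h1 h2]
    rw [this, map_zero]
  have hsum : ∀ m : ℕ, ∑ i ∈ Finset.range (k * m), TL f g x i Y = (m:ℂ) • Y x := by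
    intro m
    induction m with
    | zero => simp
    | succ m ih =>
      rw [Nat.mul_succ, Finset.sum_range_add, ih, Finset.sum_eq_single_of_mem 0 (Finset.mem_range.2 hk0), add_zero, hT0]
      · push_cast; rw [add_smul, one_smul]
      · intro i hi hi0
        exact hT1 m i (by omega) (Finset.mem_range.1 hi)
  have hsub : Tendsto (fun m : ℕ => k * m) atTop atTop := tendsto_id.const_mul_atTop' hk0
  have h2 := hY.comp hsub
  have h3 : Tendsto (fun _ : ℕ => (k:ℂ)⁻¹ • Y x) atTop (𝓝 0) := by
    refine h2.congr' ?_
    filter_upwards [eventually_gt_atTop 0] with m hm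
    have hm' : (m:ℂ) ≠ 0 := by exact_mod_cast hm.ne'
    simp only [comp_apply, hsum, smul_smul]
    congr 1
    push_cast
    field_simp
  have h4 := tendsto_nhds_unique h3 tendsto_const_nhds
  have hk' : (k:ℂ) ≠ 0 := by exact_mod_cast hk0.ne'
  have : Y x ≠ 0 := smul_ne_zero hq1 hb0
  exact smul_ne_zero (inv_ne_zero hk') this h4.symm

theorem esc (hn : 2 ≤ n) : Esc n := by
  intro N hN e he heN U hU hUne R
  by_contra! H
  obtain ⟨hf, hg, hdet⟩ := Gam.good he
  have D : Dat e e.symm := ⟨hf, hg, fun y => e.symm_apply_apply y, fun y => e.apply_symm_apply y, hdet⟩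
  have hZ : ∀ x ∈ U, ∀ (ℓ : En n →L[ℂ] ℂ) (b : En n) (q : ℂ[X]), ℓ b = 0 → 
      (fun y => q.eval (ℓ y) • b) ∈ Zs e e.symm x := by
    intro x hx ℓ b q hb
    obtain ⟨r, hr, hrU⟩ := Metric.nhds_basis_closedBall.mem_iff.1 (hU.mem_nhds hx)
    obtain ⟨C3, -, hC⟩ := bnds (R := R) D hr
    obtain ⟨t0, ht0, ht⟩ := small_shear hN heN ℓ b hb q
    refine F1 D ht0 ℓ b q (R := R) (C3 := C3) (fun i => (hC x (fun i y hy => H e he heN y (hrU hy) i) i).2) ?_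
    intro t htt m
    have := H _ (mul_mem (sh_mem ℓ b hb (Polynomial.C t * q)) he) (ht t htt) x hx m
    have e1 : (⇑(sh ℓ b hb (Polynomial.C t * q) * e)) = fun y => e y + (t * q.eval (ℓ (e y))) • b := by
      ext1 y
      change sh ℓ b hb (Polynomial.C t * q) (e y) = _
      rw [sh_apply, eval_mul, eval_C]
    rwa [e1] at this
  refine F8 hn D hZ ?_
  obtain ⟨x0, hx0⟩ := hUne
  obtain ⟨r, hr, hrU⟩ := Metric.nhds_basis_closedBall.mem_iff.1 (hU.mem_nhds hx0)
  obtain ⟨ρ, hρ, rfl⟩ : ∃ ρ > 0, r = 3 * ρ := ⟨r / 3, by positivity, by ring⟩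
  have hb : ∀ i : ℕ, ∀ y ∈ closedBall x0 (3 * ρ), ‖e^[i] y‖ ≤ R := fun i y hy => H e he heN y (hrU hy) i
  have hsub : closedBall x0 ρ ⊆ U := (closedBall_subset_closedBall (by linarith)).trans hrU
  obtain ⟨K, hK, σ, hσ, h5⟩ := F5 D hρ hb (fun x hx => hZ x (hsub hx))
  have hc : 0 < 1 + 8 / ρ := by positivity
  set c := 1 + 8 / ρ
  obtain ⟨η, hη, h1, h2, h3⟩ : ∃ η > 0, η ≤ ρ / 2 ∧ c * η ≤ σ ∧ 16 * K * c ^ 2 * η ≤ 1 := by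
    refine ⟨min (ρ/2) (min (σ/c) (1 / (16 * K * c ^ 2))), by positivity, min_le_left _ _, ?_, ?_⟩
    · rw [mul_comm, ← le_div_iff₀ hc]; exact (min_le_right _ _).trans (min_le_left _ _)
    · rw [mul_comm, ← le_div_iff₀ (by positivity)]; exact (min_le_right _ _).trans (min_le_right _ _)
  obtain ⟨k, hk0, hk⟩ := F6 D hρ hb hη
  have := F7 hn D hρ hK hη (h5 k) h1 h2 h3 hk
  exact ⟨k, hk0, ball x0 (ρ/4), (ball_subset_closedBall.trans (closedBall_subset_closedBall (by linarith))).trans hsub,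
    isOpen_ball, ⟨x0, mem_ball_self (by positivity)⟩, fun x hx => this x (ball_subset_closedBall hx)⟩

end ChaosAux

/-- For n ≥ 2, there exists a chaotic volume-preserving holomorphic
automorphism of ℂⁿ. -/
theorem stmt_1 (n : ℕ) (hn : 2 ≤ n) :
    ∃ f : En n → En n, IsHoloAut f ∧ IsVolPres f ∧ Chaotic f := by
  exact ChaosAux.main_of_esc hn (ChaosAux.esc hn)
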